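/- For all integers d ≥ 1, k ≥ 2, s ≥ 1 there exists C > 0 such that the following holds. Let V be a finite set of points in ℝ² and let Γ be a finite set of pairwise distinct plane algebraic curves, each the zero set of a nonzero real polynomial in two variables of degree at most d, such that any two distinct curves of Γ have finite intersection, and such that for any k distinct points of ℝ² there are at most s curves of Γ passing through all of them. Then the number of incidences I(V,Γ) = |{(p,γ) ∈ V × Γ : p ∈ γ}| satisfies I(V,Γ) ≤ C·(|V|^{k/(2k-1)}·|Γ|^{(2k-2)/(2k-1)} + |V| + |Γ|). -/

import Mathlib

noncomputable section

open Finset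
open scoped Classical

/-- The number of incidences between the points of `V` and the objects of `Γ`. -/
def incidenceCount {P ι : Type*} (inc : P → ι → Prop) (V : Finset P) (Γ : Finset ι) : ℕ :=
  ∑ γ ∈ Γ, #{p ∈ V | inc p γ}

section Combinatorics

variable {P ι : Type*} {inc : P → ι → Prop}

lemma incidenceCount_eq_sum_points (V : Finset P) (Γ : Finset ι) :
    incidenceCount inc V Γ = ∑ p ∈ V, #{γ ∈ Γ | inc p γ} :=
  (Finset.sum_card_bipartiteAbove_eq_sum_card_bipartiteBelow (s := V) (t := Γ) inc).symm

/-- A real number form of the binomial trick behind the Kővári–Sós–Turán bound. -/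
lemma natCast_le_add_descFactorial_div {k : ℕ} (hk : 1 ≤ k) (n : ℕ) {L : ℝ} (hL : 0 < L) :
    (n : ℝ) ≤ k + L + n.descFactorial k / L ^ (k - 1) := by
  have h0 : (0 : ℝ) ≤ n.descFactorial k / L ^ (k - 1) := by positivity
  have h1 : (n : ℝ) ≤ k + ((n + 1 - k : ℕ) : ℝ) := by
    have : n ≤ k + (n + 1 - k) := by omega
    exact_mod_cast this
  rcases le_total (((n + 1 - k : ℕ) : ℝ)) L with h | h
  · linarith
  · have h2 : ((n + 1 - k : ℕ) : ℝ) ≤ n.descFactorial k / L ^ (k - 1) := by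
      rw [le_div_iff₀ (by positivity)]
      calc ((n + 1 - k : ℕ) : ℝ) * L ^ (k - 1)
          ≤ ((n + 1 - k : ℕ) : ℝ) * ((n + 1 - k : ℕ) : ℝ) ^ (k - 1) := by gcongr
        _ = ((n + 1 - k : ℕ) : ℝ) ^ k := by rw [mul_pow_sub_one (by omega)]
        _ ≤ n.descFactorial k := by exact_mod_cast Nat.pow_sub_le_descFactorial n k
    linarith

/-- If at most `s` objects pass through any `k` points, then the number of objects, counted with
the number of `k`-subsets of `V` they contain, is at most `s` times the number of `k`-subsets. -/
lemma sum_choose_le (V : Finset P) (Γ : Finset ι) {k s : ℕ}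
    (hs : ∀ T ⊆ V, #T = k → #{γ ∈ Γ | ∀ p ∈ T, inc p γ} ≤ s) :
    ∑ γ ∈ Γ, (#{p ∈ V | inc p γ}).choose k ≤ s * (#V).choose k := by
  have h1 : ∀ γ ∈ Γ, (#{p ∈ V | inc p γ}).choose k
      = #{T ∈ V.powersetCard k | ∀ p ∈ T, inc p γ} := by
    intro γ _
    rw [← Finset.card_powersetCard]
    congr 1
    ext T
    simp only [Finset.mem_powersetCard, Finset.mem_filter, Finset.subset_iff]
    constructor
    · rintro ⟨h, h'⟩
      exact ⟨⟨fun x hx => (h hx).1, h'⟩, fun x hx => (h hx).2⟩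
    · rintro ⟨⟨h, h'⟩, h''⟩
      exact ⟨fun x hx => ⟨h hx, h'' x hx⟩, h'⟩
  rw [Finset.sum_congr rfl h1]
  have h2 := Finset.sum_card_bipartiteAbove_eq_sum_card_bipartiteBelow
    (s := V.powersetCard k) (t := Γ) (fun T γ => ∀ p ∈ T, inc p γ)
  simp only [Finset.bipartiteAbove, Finset.bipartiteBelow] at h2
  rw [← h2]
  calc _ ≤ ∑ T ∈ V.powersetCard k, s := by
        refine Finset.sum_le_sum fun T hT => ?_
        rw [Finset.mem_powersetCard] at hT
        exact hs T hT.1 hT.2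
    _ = _ := by simp [mul_comm]

/-- A linearised Kővári–Sós–Turán bound. -/
lemma incidenceCount_le_linear (V : Finset P) (Γ : Finset ι) {k s : ℕ} (hk : 1 ≤ k)
    (hs : ∀ T ⊆ V, #T = k → #{γ ∈ Γ | ∀ p ∈ T, inc p γ} ≤ s) {a : ℝ} (ha : 0 < a) :
    (incidenceCount inc V Γ : ℝ) ≤ k * #Γ + a * (#V * #Γ) + s * #V / a ^ (k - 1) := by
  rcases V.eq_empty_or_nonempty with rfl | hV
  · simp [incidenceCount]
    positivity
  have hm : (0 : ℝ) < #V := by exact_mod_cast hV.card_pos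
  set L : ℝ := a * #V with hL
  have hLpos : 0 < L := by positivity
  have h1 : (∑ γ ∈ Γ, ((#{p ∈ V | inc p γ}).descFactorial k : ℝ)) ≤ s * (#V : ℝ) ^ k := by
    have : ∑ γ ∈ Γ, (#{p ∈ V | inc p γ}).descFactorial k ≤ s * #V ^ k := by
      simp only [Nat.descFactorial_eq_factorial_mul_choose]
      rw [← Finset.mul_sum]
      calc k.factorial * ∑ γ ∈ Γ, (#{p ∈ V | inc p γ}).choose k
          ≤ k.factorial * (s * (#V).choose k) := Nat.mul_le_mul_left _ (sum_choose_le V Γ hs)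
        _ = s * (#V).descFactorial k := by rw [Nat.descFactorial_eq_factorial_mul_choose]; ring
        _ ≤ s * #V ^ k := Nat.mul_le_mul_left _ (Nat.descFactorial_le_pow _ _)
    exact_mod_cast this
  calc (incidenceCount inc V Γ : ℝ) = ∑ γ ∈ Γ, (#{p ∈ V | inc p γ} : ℝ) := by
        simp [incidenceCount]
    _ ≤ ∑ γ ∈ Γ, ((k : ℝ) + L + (#{p ∈ V | inc p γ}).descFactorial k / L ^ (k - 1)) :=
        Finset.sum_le_sum fun γ _ => natCast_le_add_descFactorial_div hk _ hLpos
    _ = #Γ * (k + L) + (∑ γ ∈ Γ, ((#{p ∈ V | inc p γ}).descFactorial k : ℝ)) / L ^ (k - 1) := by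
        rw [Finset.sum_add_distrib, Finset.sum_div]; simp; ring
    _ ≤ #Γ * (k + L) + s * (#V : ℝ) ^ k / L ^ (k - 1) := by gcongr
    _ = _ := by
        have : s * (#V : ℝ) ^ k / L ^ (k - 1) = s * #V / a ^ (k - 1) := by
          rw [hL, mul_pow, ← mul_pow_sub_one (show k ≠ 0 by omega) (#V : ℝ)]
          field_simp
        rw [this, hL]; ring

/-- The bound for the case when there are many more points than objects. -/
lemma incidenceCount_le_card_add_sq (V : Finset P) (Γ : Finset ι) {M : ℕ}
    (hM : ∀ γ ∈ Γ, ∀ γ' ∈ Γ, γ ≠ γ' → #{p ∈ V | inc p γ ∧ inc p γ'} ≤ M) :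
    incidenceCount inc V Γ ≤ #V + M * #Γ ^ 2 := by
  rw [incidenceCount_eq_sum_points]
  have h1 : ∀ p ∈ V, #{γ ∈ Γ | inc p γ} ≤ 1 + #{x ∈ Γ.offDiag | inc p x.1 ∧ inc p x.2} := by
    intro p _
    have : ({x ∈ Γ.offDiag | inc p x.1 ∧ inc p x.2} : Finset (ι × ι))
        = ({γ ∈ Γ | inc p γ} : Finset ι).offDiag := by
      ext x; simp only [Finset.mem_filter, Finset.mem_offDiag]; tauto
    rw [this, Finset.offDiag_card]
    set n := #{γ ∈ Γ | inc p γ}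
    rcases Nat.lt_or_ge n 2 with h | h
    · omega
    · have : n * 2 ≤ n * n := Nat.mul_le_mul_left _ h
      omega
  have h2 := Finset.sum_card_bipartiteAbove_eq_sum_card_bipartiteBelow
    (s := V) (t := Γ.offDiag) (fun p x => inc p x.1 ∧ inc p x.2)
  simp only [Finset.bipartiteAbove, Finset.bipartiteBelow] at h2
  calc _ ≤ ∑ p ∈ V, (1 + #{x ∈ Γ.offDiag | inc p x.1 ∧ inc p x.2}) := Finset.sum_le_sum h1
    _ = #V + ∑ x ∈ Γ.offDiag, #{p ∈ V | inc p x.1 ∧ inc p x.2} := by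
        rw [Finset.sum_add_distrib, h2]; simp
    _ ≤ #V + ∑ x ∈ Γ.offDiag, M := by
        gcongr with x hx
        rw [Finset.mem_offDiag] at hx
        exact hM _ hx.1 _ hx.2.1 hx.2.2
    _ ≤ #V + M * #Γ ^ 2 := by
        simp only [Finset.sum_const, smul_eq_mul, Finset.offDiag_card, sq]
        rw [mul_comm M]
        gcongr
        exact Nat.sub_le _ _

/-- Double counting of the pairs (subset, distinguished element). -/
lemma sum_powersetCard_succ_erase {A : Type*} [AddCommMonoid A] (Γ : Finset ι) (r : ℕ)
    (F : Finset ι → ι → A) :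
    ∑ S ∈ Γ.powersetCard (r + 1), ∑ γ ∈ S, F (S.erase γ) γ =
      ∑ R ∈ Γ.powersetCard r, ∑ γ ∈ Γ \ R, F R γ := by
  rw [Finset.sum_sigma', Finset.sum_sigma']
  refine Finset.sum_bij' (fun x _ => ⟨x.1.erase x.2, x.2⟩) (fun x _ => ⟨insert x.2 x.1, x.2⟩)
    ?_ ?_ ?_ ?_ ?_
  · rintro ⟨S, γ⟩ h
    simp only [Finset.mem_sigma, Finset.mem_powersetCard, Finset.mem_sdiff] at h ⊢
    obtain ⟨⟨h1, h2⟩, h3⟩ := h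
    refine ⟨⟨(Finset.erase_subset _ _).trans h1, ?_⟩, h1 h3, Finset.notMem_erase _ _⟩
    rw [Finset.card_erase_of_mem h3, h2]; rfl
  · rintro ⟨R, γ⟩ h
    simp only [Finset.mem_sigma, Finset.mem_powersetCard, Finset.mem_sdiff] at h ⊢
    obtain ⟨⟨h1, h2⟩, h3, h4⟩ := h
    exact ⟨⟨Finset.insert_subset h3 h1, by rw [Finset.card_insert_of_notMem h4, h2]⟩,
      Finset.mem_insert_self _ _⟩
  · rintro ⟨S, γ⟩ h
    simp only [Finset.mem_sigma] at h
    simp [Finset.insert_erase h.2]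
  · rintro ⟨R, γ⟩ h
    simp only [Finset.mem_sigma, Finset.mem_sdiff] at h
    simp [Finset.erase_insert h.2.2]
  · intros; rfl

end Combinatorics

section Sampling

variable {P ι : Type*} {inc : P → ι → Prop}

/-- The points of `V` lying on no object of `R`. -/
def freePoints (inc : P → ι → Prop) (V : Finset P) (R : Finset ι) : Finset P :=
  {p ∈ V | ∀ γ ∈ R, ¬ inc p γ}

/-- The number of classes of a relation on the free points of `V` that are met by `γ`. -/
def cellCount (inc : P → ι → Prop) (rel : Finset ι → Setoid P) (V : Finset P) (R : Finset ι)
    (γ : ι) : ℕ :=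
  #(({q ∈ freePoints inc V R | inc q γ}).image (Quotient.mk (rel R)))

lemma incidenceCount_freePoints_le (rel : Finset ι → Setoid P) (V : Finset P) (Γ R : Finset ι)
    {k s : ℕ} (hk : 1 ≤ k) (hs : ∀ T ⊆ V, #T = k → #{γ ∈ Γ | ∀ p ∈ T, inc p γ} ≤ s)
    {a : ℝ} (ha : 0 < a) :
    (incidenceCount inc (freePoints inc V R) (Γ \ R) : ℝ) ≤
      k * (∑ γ ∈ Γ \ R, cellCount inc rel V R γ : ℕ)
      + a * (∑ γ ∈ Γ \ R, #{p ∈ freePoints inc V R |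
          ∃ q ∈ freePoints inc V R, inc q γ ∧ rel R p q} : ℕ)
      + s * #V / a ^ (k - 1) := by
  set W := freePoints inc V R with hW
  set c : P → Quotient (rel R) := Quotient.mk (rel R) with hc
  set T := W.image c with hT
  let n : Quotient (rel R) → Finset ι := fun τ => {γ ∈ Γ \ R | ∃ q ∈ W, inc q γ ∧ c q = τ}
  have hWV : W ⊆ V := Finset.filter_subset _ _
  have hmaps : ∀ p ∈ W, c p ∈ T := fun p hp => Finset.mem_image_of_mem _ hp
  have e1 : incidenceCount inc W (Γ \ R)
      = ∑ τ ∈ T, incidenceCount inc {p ∈ W | c p = τ} (n τ) := by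
    unfold incidenceCount
    have : ∀ γ ∈ Γ \ R, #{p ∈ W | inc p γ} = ∑ τ ∈ T, #{p ∈ {p ∈ W | c p = τ} | inc p γ} := by
      intro γ _
      rw [Finset.card_eq_sum_card_fiberwise (f := c) (t := T)
        (fun p hp => hmaps p (Finset.mem_filter.1 hp).1)]
      refine Finset.sum_congr rfl fun τ _ => ?_
      rw [Finset.filter_filter, Finset.filter_filter]
      congr 1; ext p; simp only [Finset.mem_filter]; tauto
    rw [Finset.sum_congr rfl this, Finset.sum_comm]
    refine Finset.sum_congr rfl fun τ _ => ?_
    symm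
    refine Finset.sum_subset (Finset.filter_subset _ _) fun γ hγ hγ' => ?_
    rw [Finset.card_eq_zero, Finset.filter_eq_empty_iff]
    intro p hp hpγ
    rw [Finset.mem_filter] at hp
    exact hγ' (Finset.mem_filter.2 ⟨hγ, p, hp.1, hpγ, hp.2⟩)
  have e2 : ∑ τ ∈ T, #(n τ) = ∑ γ ∈ Γ \ R, cellCount inc rel V R γ := by
    have := Finset.sum_card_bipartiteAbove_eq_sum_card_bipartiteBelow
      (s := T) (t := Γ \ R) (fun τ γ => ∃ q ∈ W, inc q γ ∧ c q = τ)
    simp only [Finset.bipartiteAbove, Finset.bipartiteBelow] at this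
    rw [this]
    refine Finset.sum_congr rfl fun γ _ => ?_
    unfold cellCount
    congr 1
    ext τ
    simp only [Finset.mem_filter, Finset.mem_image, hT, ← hW, ← hc]
    constructor
    · rintro ⟨_, q, hq, h1, h2⟩; exact ⟨q, ⟨hq, h1⟩, h2⟩
    · rintro ⟨q, ⟨hq, h1⟩, h2⟩; exact ⟨⟨q, hq, h2⟩, q, hq, h1, h2⟩
  have e3 : ∑ τ ∈ T, #{p ∈ W | c p = τ} * #(n τ) =
      ∑ γ ∈ Γ \ R, #{p ∈ W | ∃ q ∈ W, inc q γ ∧ rel R p q} := by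
    have h1 : ∀ τ ∈ T, #{p ∈ W | c p = τ} * #(n τ) = ∑ p ∈ W with c p = τ, #(n (c p)) := by
      intro τ _
      rw [Finset.sum_congr rfl (g := fun _ => #(n τ))]
      · simp
      · intro p hp; rw [(Finset.mem_filter.1 hp).2]
    rw [Finset.sum_congr rfl h1, Finset.sum_fiberwise_of_maps_to hmaps]
    have := Finset.sum_card_bipartiteAbove_eq_sum_card_bipartiteBelow
      (s := W) (t := Γ \ R) (fun p γ => ∃ q ∈ W, inc q γ ∧ c q = c p)
    simp only [Finset.bipartiteAbove, Finset.bipartiteBelow] at this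
    rw [this]
    refine Finset.sum_congr rfl fun γ _ => ?_
    congr 1
    ext p
    simp only [Finset.mem_filter]
    refine and_congr_right fun _ => exists_congr fun q => ?_
    rw [hc, Quotient.eq]
    exact and_congr_right fun _ => and_congr_right fun _ => 
      ⟨(rel R).symm', (rel R).symm'⟩
  have e4 : ∑ τ ∈ T, #{p ∈ W | c p = τ} = #W :=
    (Finset.card_eq_sum_card_fiberwise hmaps).symm
  calc (incidenceCount inc W (Γ \ R) : ℝ)
      = ∑ τ ∈ T, (incidenceCount inc {p ∈ W | c p = τ} (n τ) : ℝ) := by rw [e1]; push_cast; rfl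
    _ ≤ ∑ τ ∈ T, ((k * #(n τ) : ℝ) + a * (#{p ∈ W | c p = τ} * #(n τ))
          + s * #{p ∈ W | c p = τ} / a ^ (k - 1)) := by
        refine Finset.sum_le_sum fun τ _ => incidenceCount_le_linear _ _ hk ?_ ha
        intro A hA hAk
        refine (Finset.card_le_card ?_).trans
          (hs A (hA.trans ((Finset.filter_subset _ _).trans hWV)) hAk)
        intro γ hγ
        simp only [n, Finset.mem_filter, Finset.mem_sdiff] at hγ ⊢
        exact ⟨hγ.1.1.1, hγ.2⟩
    _ = k * (∑ τ ∈ T, #(n τ) : ℕ) + a * (∑ τ ∈ T, #{p ∈ W | c p = τ} * #(n τ) : ℕ)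
          + s * (∑ τ ∈ T, #{p ∈ W | c p = τ} : ℕ) / a ^ (k - 1) := by
        push_cast
        rw [Finset.sum_add_distrib, Finset.sum_add_distrib, Finset.mul_sum, Finset.mul_sum,
          Finset.mul_sum, Finset.sum_div]
    _ ≤ _ := by
        rw [e2, e3, e4]
        have : (#W : ℝ) ≤ #V := by exact_mod_cast Finset.card_le_card hWV
        gcongr

lemma incidenceCount_le_sample (rel : Finset ι → Setoid P) (V : Finset P) (Γ R : Finset ι)
    (hR : R ⊆ Γ) {M k s : ℕ}
    (hM : ∀ γ ∈ Γ, ∀ γ' ∈ Γ, γ ≠ γ' → #{p ∈ V | inc p γ ∧ inc p γ'} ≤ M)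
    (hk : 1 ≤ k) (hs : ∀ T ⊆ V, #T = k → #{γ ∈ Γ | ∀ p ∈ T, inc p γ} ≤ s)
    {a : ℝ} (ha : 0 < a) :
    (incidenceCount inc V Γ : ℝ) ≤
      (∑ γ ∈ R, #{p ∈ V | inc p γ} : ℕ) + M * (#R * #Γ)
      + k * (∑ γ ∈ Γ \ R, cellCount inc rel V R γ : ℕ)
      + a * (∑ γ ∈ Γ \ R, #{p ∈ freePoints inc V R |
          ∃ q ∈ freePoints inc V R, inc q γ ∧ rel R p q} : ℕ)
      + s * #V / a ^ (k - 1) := by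
  have h1 : incidenceCount inc V Γ ≤ ∑ γ ∈ R, #{p ∈ V | inc p γ} + M * (#R * #Γ)
      + incidenceCount inc (freePoints inc V R) (Γ \ R) := by
    have : ∀ γ ∈ Γ \ R, #{p ∈ V | inc p γ} ≤ M * #R + #{p ∈ freePoints inc V R | inc p γ} := by
      intro γ hγ
      rw [Finset.mem_sdiff] at hγ
      have hsub : ({p ∈ V | inc p γ} : Finset P) ⊆
          (R.biUnion fun γ' => {p ∈ V | inc p γ ∧ inc p γ'}) ∪
            {p ∈ freePoints inc V R | inc p γ} := by
        intro p hp
        simp only [freePoints, Finset.mem_union, Finset.mem_biUnion, Finset.mem_filter] at hp ⊢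
        by_cases h : ∀ γ ∈ R, ¬ inc p γ
        · exact Or.inr ⟨⟨hp.1, h⟩, hp.2⟩
        · push Not at h
          obtain ⟨γ', h1, h2⟩ := h
          exact Or.inl ⟨γ', h1, hp.1, hp.2, h2⟩
      refine (Finset.card_le_card hsub).trans ((Finset.card_union_le _ _).trans ?_)
      gcongr
      rw [mul_comm]
      refine Finset.card_biUnion_le_card_mul _ _ _ fun γ' hγ' => hM _ hγ.1 _ (hR hγ') ?_
      rintro rfl; exact hγ.2 hγ'
    calc incidenceCount inc V Γ = ∑ γ ∈ Γ \ R, #{p ∈ V | inc p γ} + ∑ γ ∈ R, #{p ∈ V | inc p γ} :=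
          (Finset.sum_sdiff hR).symm
      _ ≤ ∑ γ ∈ Γ \ R, (M * #R + #{p ∈ freePoints inc V R | inc p γ})
          + ∑ γ ∈ R, #{p ∈ V | inc p γ} := by gcongr with γ hγ; exact this γ hγ
      _ = #(Γ \ R) * (M * #R) + incidenceCount inc (freePoints inc V R) (Γ \ R)
          + ∑ γ ∈ R, #{p ∈ V | inc p γ} := by
          rw [Finset.sum_add_distrib]; simp [incidenceCount]
      _ ≤ #Γ * (M * #R) + incidenceCount inc (freePoints inc V R) (Γ \ R)
          + ∑ γ ∈ R, #{p ∈ V | inc p γ} := by gcongr; exact Finset.sdiff_subset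
      _ = _ := by ring
  have h2 := incidenceCount_freePoints_le rel V Γ R hk hs ha
  have h3 : (incidenceCount inc V Γ : ℝ) ≤ (∑ γ ∈ R, #{p ∈ V | inc p γ} : ℕ) + M * (#R * #Γ)
      + incidenceCount inc (freePoints inc V R) (Γ \ R) := by exact_mod_cast h1
  linarith

/-- The sampling bound, in the style of Clarkson and Shor. -/
lemma incidenceCount_le_of_sampling (rel : Finset ι → Setoid P) (V : Finset P) (Γ : Finset ι)
    {M k s D₁ D₂ : ℕ}
    (hM : ∀ γ ∈ Γ, ∀ γ' ∈ Γ, γ ≠ γ' → #{p ∈ V | inc p γ ∧ inc p γ'} ≤ M)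
    (hk : 1 ≤ k) (hs : ∀ T ⊆ V, #T = k → #{γ ∈ Γ | ∀ p ∈ T, inc p γ} ≤ s)
    (hD₁ : ∀ S ⊆ Γ, ∀ p ∈ V, #{γ ∈ S | p ∈ freePoints inc V (S.erase γ) ∧
      ∃ q ∈ freePoints inc V (S.erase γ), inc q γ ∧ rel (S.erase γ) p q} ≤ D₁)
    (hD₂ : ∀ S ⊆ Γ, ∑ γ ∈ S, cellCount inc rel V (S.erase γ) γ ≤ D₂ * #S ^ 2)
    {a : ℝ} (ha : 0 < a) {r : ℕ} (hr : 1 ≤ r) (hrN : 3 * r ≤ #Γ) :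
    (incidenceCount inc V Γ : ℝ) ≤
      2 * ((M + 2 * k * D₂) * (r * #Γ) + a * D₁ * (#V * #Γ / r) + s * #V / a ^ (k - 1)) := by
  set N := #Γ with hN
  set I := incidenceCount inc V Γ with hI
  have hNr : r ≤ N := by omega
  have hB : (0 : ℝ) < N.choose r := by exact_mod_cast Nat.choose_pos hNr
  have s1 : ∑ R ∈ Γ.powersetCard r, ∑ γ ∈ R, #{p ∈ V | inc p γ} ≤ N.choose (r - 1) * I := by
    obtain ⟨r', rfl⟩ : ∃ r', r = r' + 1 := ⟨r - 1, by omega⟩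
    rw [sum_powersetCard_succ_erase Γ r' (fun _ γ => #{p ∈ V | inc p γ})]
    calc _ ≤ ∑ R ∈ Γ.powersetCard r', I :=
          Finset.sum_le_sum fun R _ => Finset.sum_le_sum_of_subset Finset.sdiff_subset
      _ = _ := by simp [Finset.card_powersetCard, hN]
  have s2 : ∑ R ∈ Γ.powersetCard r, ∑ γ ∈ Γ \ R, cellCount inc rel V R γ
      ≤ N.choose (r + 1) * (D₂ * (r + 1) ^ 2) := by
    rw [← sum_powersetCard_succ_erase Γ r (fun R γ => cellCount inc rel V R γ)]
    calc _ ≤ ∑ S ∈ Γ.powersetCard (r + 1), D₂ * (r + 1) ^ 2 := by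
          refine Finset.sum_le_sum fun S hS => ?_
          rw [Finset.mem_powersetCard] at hS
          rw [← hS.2]; exact hD₂ S hS.1
      _ = _ := by simp [Finset.card_powersetCard, hN]
  have s3 : ∑ R ∈ Γ.powersetCard r, ∑ γ ∈ Γ \ R, #{p ∈ freePoints inc V R |
          ∃ q ∈ freePoints inc V R, inc q γ ∧ rel R p q} ≤ N.choose (r + 1) * (#V * D₁) := by
    rw [← sum_powersetCard_succ_erase Γ r (fun R γ => #{p ∈ freePoints inc V R |
          ∃ q ∈ freePoints inc V R, inc q γ ∧ rel R p q})]
    calc _ ≤ ∑ S ∈ Γ.powersetCard (r + 1), #V * D₁ := by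
          refine Finset.sum_le_sum fun S hS => ?_
          rw [Finset.mem_powersetCard] at hS
          have := Finset.sum_card_bipartiteAbove_eq_sum_card_bipartiteBelow
            (s := V) (t := S) (fun p γ => p ∈ freePoints inc V (S.erase γ) ∧
              ∃ q ∈ freePoints inc V (S.erase γ), inc q γ ∧ rel (S.erase γ) p q)
          simp only [Finset.bipartiteAbove, Finset.bipartiteBelow] at this
          calc _ = ∑ γ ∈ S, #{p ∈ V | p ∈ freePoints inc V (S.erase γ) ∧
              ∃ q ∈ freePoints inc V (S.erase γ), inc q γ ∧ rel (S.erase γ) p q} := by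
                refine Finset.sum_congr rfl fun γ _ => ?_
                congr 1
                ext p
                simp only [Finset.mem_filter]
                have : p ∈ freePoints inc V (S.erase γ) → p ∈ V :=
                  fun h => (Finset.mem_filter.1 h).1
                tauto
            _ ≤ ∑ p ∈ V, D₁ := by
                rw [← this]; exact Finset.sum_le_sum fun p hp => hD₁ S hS.1 p hp
            _ = _ := by simp
      _ = _ := by simp [Finset.card_powersetCard, hN]
  have c1 : (2 : ℝ) * N.choose (r - 1) ≤ N.choose r := by
    have h := Nat.choose_succ_right_eq N (r - 1)
    rw [Nat.sub_add_cancel hr] at h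
    have h2 : 2 * N.choose (r - 1) * r ≤ N.choose r * r := by
      rw [h, mul_comm 2, mul_assoc]
      exact Nat.mul_le_mul_left _ (by omega)
    exact_mod_cast Nat.le_of_mul_le_mul_right h2 (by omega)
  have c2 : (N.choose (r + 1) : ℝ) * (r + 1) ≤ N.choose r * N := by
    have h := Nat.choose_succ_right_eq N r
    have h2 : N.choose (r + 1) * (r + 1) ≤ N.choose r * N := by
      rw [h]; exact Nat.mul_le_mul_left _ (Nat.sub_le _ _)
    exact_mod_cast h2
  have key : (N.choose r : ℝ) * I ≤ N.choose (r - 1) * I + N.choose r * (M * (r * N))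
      + k * (N.choose (r + 1) * (D₂ * (r + 1) ^ 2)) + a * (N.choose (r + 1) * (#V * D₁))
      + N.choose r * (s * #V / a ^ (k - 1)) := by
    have h0 : ∑ R ∈ Γ.powersetCard r, (I : ℝ) ≤ ∑ R ∈ Γ.powersetCard r,
      ((∑ γ ∈ R, #{p ∈ V | inc p γ} : ℕ) + M * (r * N)
      + k * (∑ γ ∈ Γ \ R, cellCount inc rel V R γ : ℕ)
      + a * (∑ γ ∈ Γ \ R, #{p ∈ freePoints inc V R |
          ∃ q ∈ freePoints inc V R, inc q γ ∧ rel R p q} : ℕ)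
      + s * #V / a ^ (k - 1) : ℝ) := by
      refine Finset.sum_le_sum fun R hR => ?_
      rw [Finset.mem_powersetCard] at hR
      have := incidenceCount_le_sample rel V Γ R hR.1 hM hk hs ha
      rwa [hR.2] at this
    simp only [Finset.sum_add_distrib, ← Finset.mul_sum, ← Nat.cast_sum, Finset.sum_const,
      Finset.card_powersetCard, nsmul_eq_mul, ← hN] at h0
    simp only [Nat.cast_mul, Nat.cast_id] at h0
    rw [show (M : ℝ) * (r * (N.choose r * N)) = N.choose r * (M * (r * N)) by ring] at h0
    refine h0.trans ?_
    gcongr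
    · exact_mod_cast s1
    · exact_mod_cast s2
    · exact_mod_cast s3
  have hr0 : (1 : ℝ) ≤ r := by exact_mod_cast hr
  have t1 : (N.choose (r + 1) : ℝ) * (D₂ * (r + 1) ^ 2) ≤ N.choose r * (2 * D₂ * (r * N)) := by
    calc (N.choose (r + 1) : ℝ) * (D₂ * (r + 1) ^ 2)
        = (N.choose (r + 1) * (r + 1)) * (D₂ * (r + 1)) := by ring
      _ ≤ (N.choose r * N) * (D₂ * (r + r)) := by gcongr
      _ = _ := by ring
  have t2 : (N.choose (r + 1) : ℝ) * (#V * D₁) ≤ N.choose r * (D₁ * (#V * N / r)) := by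
    have : (N.choose (r + 1) : ℝ) ≤ N.choose r * N / r := by
      rw [le_div_iff₀ (by linarith)]
      refine le_trans ?_ c2
      gcongr; linarith
    calc (N.choose (r + 1) : ℝ) * (#V * D₁) ≤ (N.choose r * N / r) * (#V * D₁) := by gcongr
      _ = _ := by ring
  have hI0 : (0 : ℝ) ≤ I := Nat.cast_nonneg _
  have fin : (N.choose r : ℝ) * I ≤ N.choose r * (I / 2 + (M * (r * N)
      + k * (2 * D₂ * (r * N)) + a * (D₁ * (#V * N / r)) + s * #V / a ^ (k - 1))) := by
    have u0 : (N.choose (r - 1) : ℝ) * I ≤ N.choose r * (I / 2) := by nlinarith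
    have u1 := mul_le_mul_of_nonneg_left t1 (Nat.cast_nonneg (α := ℝ) k)
    have u2 := mul_le_mul_of_nonneg_left t2 ha.le
    linarith
  have := le_of_mul_le_mul_left fin hB
  have : (I : ℝ) ≤ 2 * (M * (r * N)
      + k * (2 * D₂ * (r * N)) + a * (D₁ * (#V * N / r)) + s * #V / a ^ (k - 1)) := by linarith
  refine this.trans (le_of_eq ?_)
  ring

end Sampling

section Optimization

lemma rpow_balance {k : ℕ} (hk : 2 ≤ k) {m N : ℝ} (hm : 0 ≤ m) (hN : 0 ≤ N) :
    m ^ ((k : ℝ) / (2 * k - 1)) * N ^ ((2 * (k : ℝ) - 2) / (2 * k - 1)) =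
      (m ^ ((2 * k - 1 : ℝ)⁻¹)) ^ k * (N ^ ((2 * k - 1 : ℝ)⁻¹)) ^ (2 * (k - 1)) := by
  rw [← Real.rpow_natCast (m ^ _), ← Real.rpow_natCast (N ^ _), ← Real.rpow_mul hm,
    ← Real.rpow_mul hN]
  have h1 : ((2 * (k - 1) : ℕ) : ℝ) = 2 * k - 2 := by
    push_cast [Nat.cast_sub (show 1 ≤ k by omega)]; ring
  rw [h1]
  congr 2 <;> ring

lemma rpow_inv_pow {k : ℕ} (hk : 2 ≤ k) {m : ℝ} (hm : 0 ≤ m) :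
    (m ^ ((2 * k - 1 : ℝ)⁻¹)) ^ (2 * (k - 1) + 1) = m := by
  have h1 : ((2 * (k - 1) + 1 : ℕ) : ℝ) = 2 * k - 1 := by
    push_cast [Nat.cast_sub (show 1 ≤ k by omega)]; ring
  have h2 : (2 : ℝ) ≤ k := by exact_mod_cast hk
  rw [← Real.rpow_natCast, h1, ← Real.rpow_mul hm, inv_mul_cancel₀ (by linarith), Real.rpow_one]

/-- Choosing the sample size optimally. -/
lemma le_of_sampling_bounds {k s M m N : ℕ} {A D I : ℝ} (hk : 2 ≤ k) (hA : 0 ≤ A) (hD : 0 ≤ D)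
    (h₁ : ∀ a : ℝ, 0 < a → I ≤ k * N + a * (m * N) + s * m / a ^ (k - 1))
    (h₂ : I ≤ m + M * (N : ℝ) ^ 2)
    (h₃ : ∀ a : ℝ, 0 < a → ∀ r : ℕ, 1 ≤ r → 3 * r ≤ N →
      I ≤ 2 * (A * (r * N) + a * D * (m * N / r) + s * m / a ^ (k - 1))) :
    I ≤ (k + 2 + 3 * s + 9 * M + 2 * A + 4 * D) *
      ((m : ℝ) ^ ((k : ℝ) / (2 * k - 1)) * (N : ℝ) ^ ((2 * (k : ℝ) - 2) / (2 * k - 1)) + m + N) := by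
  set F : ℝ := (m : ℝ) ^ ((k : ℝ) / (2 * k - 1)) * (N : ℝ) ^ ((2 * (k : ℝ) - 2) / (2 * k - 1))
    with hF
  have hF0 : 0 ≤ F := by positivity
  set K : ℝ := k + 2 + 3 * s + 9 * M + 2 * A + 4 * D with hK
  have hs0 : (0 : ℝ) ≤ s := Nat.cast_nonneg _
  have hk0 : (0 : ℝ) ≤ k := Nat.cast_nonneg _
  have hM0 : (0 : ℝ) ≤ M := Nat.cast_nonneg _
  have hm0 : (0 : ℝ) ≤ m := Nat.cast_nonneg _
  have hN0 : (0 : ℝ) ≤ N := Nat.cast_nonneg _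
  have finish : ∀ x : ℝ, ∀ c : ℝ, 0 ≤ c → c ≤ K → I ≤ c * x → 0 ≤ x → x ≤ F + m + N →
      I ≤ K * (F + m + N) := fun x c hc hcK hI hx hxF =>
    hI.trans (mul_le_mul hcK hxF hx (hc.trans hcK))
  rcases Nat.eq_zero_or_pos m with hm | hm
  · refine finish N (k) hk0 (by linarith) ?_ hN0 (by linarith)
    have := h₁ 1 one_pos
    simpa [hm] using this
  rcases Nat.eq_zero_or_pos N with hN | hN
  · refine finish m 1 zero_le_one (by linarith) ?_ hm0 (by linarith)
    simpa [hN] using h₂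
  have hm1 : (1 : ℝ) ≤ m := by exact_mod_cast hm
  have hN1 : (1 : ℝ) ≤ N := by exact_mod_cast hN
  obtain ⟨j, rfl⟩ : ∃ j, k = j + 1 := ⟨k - 1, by omega⟩
  set u : ℝ := (m : ℝ) ^ ((2 * (j + 1 : ℕ) - 1 : ℝ)⁻¹) with hu
  set v : ℝ := (N : ℝ) ^ ((2 * (j + 1 : ℕ) - 1 : ℝ)⁻¹) with hv
  have hu0 : 0 < u := Real.rpow_pos_of_pos (by linarith) _
  have hv0 : 0 < v := Real.rpow_pos_of_pos (by linarith) _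
  have hum : u ^ (2 * j + 1) = m := rpow_inv_pow hk hm0
  have hvN : v ^ (2 * j + 1) = N := rpow_inv_pow hk hN0
  have hFuv : F = u ^ (j + 1) * v ^ (2 * j) := rpow_balance hk hm0 hN0
  simp only [Nat.add_sub_cancel] at h₁ h₃
  rcases lt_or_ge (u ^ (j + 1)) v with hX | hX
  · -- few points
    have hmk : (m : ℝ) ^ (j + 1) ≤ N := by
      rw [← hum, ← hvN, ← pow_mul, mul_comm, pow_mul]
      gcongr
    refine finish N ((j + 1 : ℕ) + 1 + s) (by positivity) (by rw [hK]; linarith) ?_ hN0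
      (by linarith)
    have h := h₁ (1 / m) (by positivity)
    have e1 : 1 / (m : ℝ) * (m * N) = N := by field_simp
    have e2 : (s : ℝ) * m / (1 / (m : ℝ)) ^ j = s * m ^ (j + 1) := by
      rw [one_div, inv_pow, div_inv_eq_mul, pow_succ]; ring
    rw [e1, e2] at h
    nlinarith [mul_le_mul_of_nonneg_left hmk hs0]
  rcases lt_or_ge (v ^ (2 * j + 2)) (3 * u ^ (j + 1)) with hY | hY
  · -- many points
    refine finish m (1 + 9 * M) (by positivity) (by rw [hK]; push_cast; linarith) ?_ hm0
      (by linarith)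
    have hNm : (N : ℝ) ^ 2 ≤ 9 * m := by
      have h0 : (v ^ (2 * j + 2)) ^ 2 ≤ (3 * u ^ (j + 1)) ^ 2 := by gcongr
      have h0' : (N : ℝ) ^ 2 * v ^ 2 ≤ 9 * m * u := by
        calc (N : ℝ) ^ 2 * v ^ 2 = (v ^ (2 * j + 2)) ^ 2 := by rw [← hvN]; ring
          _ ≤ (3 * u ^ (j + 1)) ^ 2 := h0
          _ = 9 * m * u := by rw [← hum]; ring
      rcases le_total u (v ^ 2) with h | h
      · have : (N : ℝ) ^ 2 * u ≤ 9 * m * u := le_trans (by gcongr) h0'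
        exact le_of_mul_le_mul_right this hu0
      · have : (N : ℝ) ^ 2 ≤ m := by
          rw [← hum, ← hvN, ← pow_mul, mul_comm, pow_mul]
          gcongr
        linarith
    nlinarith [mul_le_mul_of_nonneg_left hNm hM0]
  · -- the main range
    set X : ℝ := u ^ (j + 1) / v with hXdef
    have hX1 : 1 ≤ X := by rw [hXdef, one_le_div hv0]; exact hX
    have hX0 : 0 < X := by linarith
    set r := ⌊X⌋₊ with hr
    have hr1 : 1 ≤ r := by rw [hr, Nat.one_le_floor_iff]; exact hX1
    have hrX : (r : ℝ) ≤ X := Nat.floor_le (by linarith)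
    have hXr : X ≤ 2 * r := by
      have := Nat.lt_floor_add_one X
      have h1 : (1 : ℝ) ≤ r := by exact_mod_cast hr1
      rw [← hr] at this; linarith
    have hr0 : (0 : ℝ) < r := by exact_mod_cast hr1
    have h3 : 3 * X ≤ N := by
      rw [hXdef, ← mul_div_assoc, div_le_iff₀ hv0, ← hvN, ← pow_succ]; exact hY
    have h3r : 3 * r ≤ N := by
      have : (3 * r : ℝ) ≤ N := by linarith
      exact_mod_cast this
    refine finish F (2 * A + 4 * D + 2 * s) (by positivity) (by rw [hK]; push_cast; linarith) ?_ hF0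
      (by linarith)
    have h := h₃ (u / v ^ 2) (by positivity) r hr1 h3r
    have e1 : (r : ℝ) * N ≤ F := by
      calc (r : ℝ) * N ≤ X * N := by gcongr
        _ = F := by rw [hXdef, hFuv, ← hvN]; field_simp; ring
    have e2 : u / v ^ 2 * D * (m * N / r) ≤ D * (2 * F) := by
      have : u / v ^ 2 * (m * N / r) ≤ 2 * F := by
        calc u / v ^ 2 * (m * N / r) ≤ u / v ^ 2 * (m * N / (X / 2)) := by
              gcongr; linarith
          _ = 2 * F := by
              rw [hXdef, hFuv, ← hum, ← hvN]
              field_simp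
              ring
      calc u / v ^ 2 * D * (m * N / r) = D * (u / v ^ 2 * (m * N / r)) := by ring
        _ ≤ _ := by gcongr
    have e3 : (s : ℝ) * m / (u / v ^ 2) ^ j = s * F := by
      rw [hFuv, ← hum, div_pow, ← pow_mul]
      field_simp
      ring
    rw [e3] at h
    nlinarith [mul_le_mul_of_nonneg_left e1 hA]

end Optimization

/-- A family of `x`-monotone arcs: the arc `a` is the graph of the function `fn a`, continuous
over the compact interval `dom a`. -/
structure ArcFamily (ι : Type*) where
  left : ι → ℝ
  right : ι → ℝ
  fn : ι → ℝ → ℝ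
  continuousOn : ∀ a, ContinuousOn (fn a) (Set.Icc (left a) (right a))

namespace ArcFamily

variable {ι : Type*} (A : ArcFamily ι)

/-- The interval over which an arc lives. -/
def dom (a : ι) : Set ℝ := Set.Icc (A.left a) (A.right a)

/-- The point `p` lies on the arc `a`. -/
def On (p : ℝ × ℝ) (a : ι) : Prop := p.1 ∈ A.dom a ∧ A.fn a p.1 = p.2

/-- The family of arcs reflected in the `x`-axis. -/
@[simps] def neg : ArcFamily ι where
  left := A.left
  right := A.right
  fn a x := -A.fn a x
  continuousOn a := (A.continuousOn a).neg

@[simp] lemma dom_neg (a : ι) : A.neg.dom a = A.dom a := rfl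

/-- The points `p` and `q` lie between the arcs `b` and `t` of `R`, and over the closed interval
spanned by their abscissae no other arc of `R` meets the closed region between `b` and `t`. -/
structure Between (R : Finset ι) (t b : ι) (p q : ℝ × ℝ) : Prop where
  top_mem : t ∈ R
  bot_mem : b ∈ R
  top_dom : Set.uIcc p.1 q.1 ⊆ A.dom t
  bot_dom : Set.uIcc p.1 q.1 ⊆ A.dom b
  lt_top_left : p.2 < A.fn t p.1
  bot_lt_left : A.fn b p.1 < p.2
  lt_top_right : q.2 < A.fn t q.1
  bot_lt_right : A.fn b q.1 < q.2
  clean : ∀ a ∈ R, a ≠ t → a ≠ b → ∀ x ∈ Set.uIcc p.1 q.1, x ∈ A.dom a →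
    A.fn b x ≤ A.fn a x → A.fn a x ≤ A.fn t x → False

variable {A}

lemma Between.symm {R : Finset ι} {t b : ι} {p q : ℝ × ℝ} (h : A.Between R t b p q) :
    A.Between R t b q p where
  top_mem := h.top_mem
  bot_mem := h.bot_mem
  top_dom := by rw [Set.uIcc_comm]; exact h.top_dom
  bot_dom := by rw [Set.uIcc_comm]; exact h.bot_dom
  lt_top_left := h.lt_top_right
  bot_lt_left := h.bot_lt_right
  lt_top_right := h.lt_top_left
  bot_lt_right := h.bot_lt_left
  clean := by rw [Set.uIcc_comm]; exact h.clean

/-- The upper arc is the lowest arc above `p`. -/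
lemma Between.top_lt {R : Finset ι} {t b : ι} {p q : ℝ × ℝ} (h : A.Between R t b p q)
    {a : ι} (ha : a ∈ R) (hat : a ≠ t) (hd : p.1 ∈ A.dom a) (hp : p.2 < A.fn a p.1) :
    A.fn t p.1 < A.fn a p.1 := by
  by_contra! hc
  refine h.clean a ha hat ?_ p.1 Set.left_mem_uIcc hd (h.bot_lt_left.le.trans hp.le) hc
  rintro rfl
  exact lt_asymm hp h.bot_lt_left

/-- The lower arc is the highest arc below `p`. -/
lemma Between.lt_bot {R : Finset ι} {t b : ι} {p q : ℝ × ℝ} (h : A.Between R t b p q)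
    {a : ι} (ha : a ∈ R) (hab : a ≠ b) (hd : p.1 ∈ A.dom a) (hp : A.fn a p.1 < p.2) :
    A.fn a p.1 < A.fn b p.1 := by
  by_contra! hc
  refine h.clean a ha ?_ hab p.1 Set.left_mem_uIcc hd hc (hp.le.trans h.lt_top_left.le)
  rintro rfl
  exact lt_asymm hp h.lt_top_left

lemma Between.top_unique {R : Finset ι} {t b t' b' : ι} {p q q' : ℝ × ℝ}
    (h : A.Between R t b p q) (h' : A.Between R t' b' p q') : t = t' := by
  by_contra hne
  exact lt_asymm
    (h.top_lt h'.top_mem (Ne.symm hne) (h'.top_dom Set.left_mem_uIcc) h'.lt_top_left)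
    (h'.top_lt h.top_mem hne (h.top_dom Set.left_mem_uIcc) h.lt_top_left)

lemma Between.bot_unique {R : Finset ι} {t b t' b' : ι} {p q q' : ℝ × ℝ}
    (h : A.Between R t b p q) (h' : A.Between R t' b' p q') : b = b' := by
  by_contra hne
  exact lt_asymm
    (h.lt_bot h'.bot_mem (Ne.symm hne) (h'.bot_dom Set.left_mem_uIcc) h'.bot_lt_left)
    (h'.lt_bot h.bot_mem hne (h.bot_dom Set.left_mem_uIcc) h.bot_lt_left)

lemma Between.trans {R : Finset ι} {t b : ι} {p q w : ℝ × ℝ}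
    (h : A.Between R t b p q) (h' : A.Between R t b q w) : A.Between R t b p w := by
  have hsub : Set.uIcc p.1 w.1 ⊆ Set.uIcc p.1 q.1 ∪ Set.uIcc q.1 w.1 :=
    Set.uIcc_subset_uIcc_union_uIcc
  exact
  { top_mem := h.top_mem
    bot_mem := h.bot_mem
    top_dom := hsub.trans (Set.union_subset h.top_dom h'.top_dom)
    bot_dom := hsub.trans (Set.union_subset h.bot_dom h'.bot_dom)
    lt_top_left := h.lt_top_left
    bot_lt_left := h.bot_lt_left
    lt_top_right := h'.lt_top_right
    bot_lt_right := h'.bot_lt_right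
    clean := fun a ha hat hab x hx => (hsub hx).elim (h.clean a ha hat hab x)
      (h'.clean a ha hat hab x) }

variable (A)

/-- Two points are in the same cell of the vertical decomposition determined by `R`. Points below
or above a vertex of the arrangement are only related to themselves. -/
def cellSetoid (R : Finset ι) : Setoid (ℝ × ℝ) where
  r p q := p = q ∨ ∃ t b, A.Between R t b p q
  iseqv :=
    { refl := fun _ => Or.inl rfl
      symm := by
        rintro p q (rfl | ⟨t, b, h⟩)
        · exact Or.inl rfl
        · exact Or.inr ⟨t, b, h.symm⟩
      trans := by
        rintro p q w (rfl | ⟨t, b, h⟩) (rfl | ⟨t', b', hqw⟩)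
        · exact Or.inl rfl
        · exact Or.inr ⟨t', b', hqw⟩
        · exact Or.inr ⟨t, b, h⟩
        · obtain rfl := h.symm.top_unique hqw
          obtain rfl := h.symm.bot_unique hqw
          exact Or.inr ⟨t, b, h.trans hqw⟩ }

/-- Backward analysis: removing an arc of `S` rarely creates a cell around `p` met by that arc. -/
lemma card_conflict_le (S : Finset ι) (p : ℝ × ℝ)
    (htop : ∃ a ∈ S, p.1 ∈ A.dom a ∧ p.2 < A.fn a p.1)
    (hbot : ∃ a ∈ S, p.1 ∈ A.dom a ∧ A.fn a p.1 < p.2) :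
    #{γ ∈ S | (∀ a ∈ S.erase γ, ¬ A.On p a) ∧ ∃ q, A.On q γ ∧ A.cellSetoid (S.erase γ) p q}
      ≤ 5 := by
  obtain ⟨t₀, ht₀, ht₀'⟩ := Finset.exists_min_image {a ∈ S | p.1 ∈ A.dom a ∧ p.2 < A.fn a p.1}
    (fun a => A.fn a p.1) (by
      obtain ⟨a, h⟩ := htop; exact ⟨a, Finset.mem_filter.2 h⟩)
  obtain ⟨b₀, hb₀, hb₀'⟩ := Finset.exists_max_image {a ∈ S | p.1 ∈ A.dom a ∧ A.fn a p.1 < p.2}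
    (fun a => A.fn a p.1) (by
      obtain ⟨a, h⟩ := hbot; exact ⟨a, Finset.mem_filter.2 h⟩)
  rw [Finset.mem_filter] at ht₀ hb₀
  let X₁ : Finset ι := {γ ∈ S | (∀ a ∈ S.erase γ, ¬ A.On p a) ∧ A.On p γ}
  let Y (P : ℝ → Prop) : Finset ι :=
    {γ ∈ S | γ ≠ t₀ ∧ γ ≠ b₀ ∧ ∃ q, P q.1 ∧ A.On q γ ∧ A.Between (S.erase γ) t₀ b₀ p q}
  have hY : ∀ P : ℝ → Prop, (∀ x y, P x → P y →
      x ∈ Set.uIcc p.1 y ∨ y ∈ Set.uIcc p.1 x) → #(Y P) ≤ 1 := by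
    intro P hP
    have key : ∀ γ₁ ∈ S, ∀ γ₂ ∈ S, γ₁ ≠ γ₂ → γ₁ ≠ t₀ → γ₁ ≠ b₀ → ∀ q₁ q₂ : ℝ × ℝ,
        A.On q₁ γ₁ → A.Between (S.erase γ₁) t₀ b₀ p q₁ → A.Between (S.erase γ₂) t₀ b₀ p q₂ →
        q₁.1 ∈ Set.uIcc p.1 q₂.1 → False := by
      intro γ₁ h1 γ₂ h2 hne hne1 hne2 q₁ q₂ hon hb1 hb2 hq
      refine hb2.clean γ₁ (Finset.mem_erase.2 ⟨hne, h1⟩) hne1 hne2 q₁.1 hq hon.1 ?_ ?_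
      · rw [hon.2]; exact hb1.bot_lt_right.le
      · rw [hon.2]; exact hb1.lt_top_right.le
    rw [Finset.card_le_one]
    intro γ₁ h1 γ₂ h2
    simp only [Y, Finset.mem_filter] at h1 h2
    obtain ⟨h1, h1t, h1b, q₁, hP1, ho1, hb1⟩ := h1
    obtain ⟨h2, h2t, h2b, q₂, hP2, ho2, hb2⟩ := h2
    by_contra hne
    rcases hP q₁.1 q₂.1 hP1 hP2 with h | h
    · exact key γ₁ h1 γ₂ h2 hne h1t h1b q₁ q₂ ho1 hb1 hb2 h
    · exact key γ₂ h2 γ₁ h1 (Ne.symm hne) h2t h2b q₂ q₁ ho2 hb2 hb1 h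
  have hX₁ : #X₁ ≤ 1 := by
    rw [Finset.card_le_one]
    intro γ₁ h1 γ₂ h2
    simp only [X₁, Finset.mem_filter] at h1 h2
    by_contra hne
    exact h1.2.1 γ₂ (Finset.mem_erase.2 ⟨Ne.symm hne, h2.1⟩) h2.2.2
  have hsub : ({γ ∈ S | (∀ a ∈ S.erase γ, ¬ A.On p a) ∧
      ∃ q, A.On q γ ∧ A.cellSetoid (S.erase γ) p q} : Finset ι) ⊆
      ({t₀, b₀} : Finset ι) ∪ X₁ ∪ Y (p.1 ≤ ·) ∪ Y (· ≤ p.1) := by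
    intro γ hγ
    rw [Finset.mem_filter] at hγ
    obtain ⟨hγ, hfree, q, hq, hrel⟩ := hγ
    simp only [Finset.mem_union, Finset.mem_insert, Finset.mem_singleton]
    by_cases h1 : γ = t₀
    · tauto
    by_cases h2 : γ = b₀
    · tauto
    rcases hrel with rfl | ⟨t, b, hb⟩
    · exact Or.inl (Or.inl (Or.inr (Finset.mem_filter.2 ⟨hγ, hfree, hq⟩)))
    have htt : t₀ = t := by
      by_contra hne
      have := hb.top_lt (Finset.mem_erase.2 ⟨Ne.symm h1, ht₀.1⟩) hne ht₀.2.1 ht₀.2.2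
      exact absurd (ht₀' t (Finset.mem_filter.2 ⟨(Finset.mem_erase.1 hb.top_mem).2,
        hb.top_dom Set.left_mem_uIcc, hb.lt_top_left⟩)) (not_le.2 this)
    have hbb : b₀ = b := by
      by_contra hne
      have := hb.lt_bot (Finset.mem_erase.2 ⟨Ne.symm h2, hb₀.1⟩) hne hb₀.2.1 hb₀.2.2
      exact absurd (hb₀' b (Finset.mem_filter.2 ⟨(Finset.mem_erase.1 hb.bot_mem).2,
        hb.bot_dom Set.left_mem_uIcc, hb.bot_lt_left⟩)) (not_le.2 this)
    subst htt hbb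
    rcases le_total p.1 q.1 with h | h
    · exact Or.inl (Or.inr (Finset.mem_filter.2 ⟨hγ, h1, h2, q, h, hq, hb⟩))
    · exact Or.inr (Finset.mem_filter.2 ⟨hγ, h1, h2, q, h, hq, hb⟩)
  have hr := hY (p.1 ≤ ·) (by
    intro x y hx hy
    rcases le_total x y with h | h
    · exact Or.inl (Set.mem_uIcc.2 (Or.inl ⟨hx, h⟩))
    · exact Or.inr (Set.mem_uIcc.2 (Or.inl ⟨hy, h⟩)))
  have hl := hY (· ≤ p.1) (by
    intro x y hx hy
    rcases le_total x y with h | h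
    · exact Or.inr (Set.mem_uIcc.2 (Or.inr ⟨h, hy⟩))
    · exact Or.inl (Set.mem_uIcc.2 (Or.inr ⟨h, hx⟩)))
  have h2 : #({t₀, b₀} : Finset ι) ≤ 2 := Finset.card_le_two
  have u1 := Finset.card_union_le ({t₀, b₀} : Finset ι) X₁
  have u2 := Finset.card_union_le (({t₀, b₀} : Finset ι) ∪ X₁) (Y (p.1 ≤ ·))
  have u3 := Finset.card_union_le (({t₀, b₀} : Finset ι) ∪ X₁ ∪ Y (p.1 ≤ ·)) (Y (· ≤ p.1))
  have u0 := Finset.card_le_card hsub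
  omega

end ArcFamily

namespace ArcFamily

variable {ι : Type*} (A : ArcFamily ι)

/-- The abscissae of the common points of two arcs. -/
def meet (a b : ι) : Set ℝ := {x | x ∈ A.dom a ∧ x ∈ A.dom b ∧ A.fn a x = A.fn b x}

@[simp] lemma meet_neg (a b : ι) : A.neg.meet a b = A.meet a b := by
  ext x; simp [meet]

/-- The vertices of the arrangement of `R`: endpoints and intersection points of arcs. -/
def IsVertex (R : Finset ι) (e : ℝ × ℝ) : Prop :=
  (∃ a ∈ R, A.On e a ∧ (e.1 = A.left a ∨ e.1 = A.right a)) ∨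
    ∃ a ∈ R, ∃ b ∈ R, a ≠ b ∧ A.On e a ∧ A.On e b

/-- The vertex `e` of the arrangement of `R` lies above `γ`, and no arc of `R` separates them. -/
structure VisibleAbove (R : Finset ι) (γ : ι) (e : ℝ × ℝ) : Prop where
  isVertex : A.IsVertex R e
  mem_dom : e.1 ∈ A.dom γ
  lt : A.fn γ e.1 < e.2
  le : ∀ a ∈ R, e.1 ∈ A.dom a → A.fn γ e.1 ≤ A.fn a e.1 → e.2 ≤ A.fn a e.1

lemma eventually_fn_lt {a b : ι} {x : ℝ} (ha : x ∈ A.dom a) (hb : x ∈ A.dom b)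
    (h : A.fn a x < A.fn b x) :
    ∀ᶠ y in nhds x, y ∈ A.dom a → y ∈ A.dom b → A.fn a y < A.fn b y := by
  have h1 := ((A.continuousOn a).mono Set.inter_subset_left) x ⟨ha, hb⟩
  have h2 := ((A.continuousOn b).mono Set.inter_subset_right) x ⟨ha, hb⟩
  have := h1.eventually_lt h2 h
  rw [eventually_nhdsWithin_iff] at this
  filter_upwards [this] with y hy h3 h4 using hy ⟨h3, h4⟩

lemma eventually_notMem_dom {a : ι} {x : ℝ} (ha : x ∉ A.dom a) : ∀ᶠ y in nhds x, y ∉ A.dom a :=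
  isClosed_Icc.isOpen_compl.mem_nhds ha

/-- If nothing happens above `γ` over `[u, v]`, a single arc is the lowest one above `γ`. -/
lemma exists_lowest_above {R : Finset ι} {γ : ι} {u v : ℝ} (huv : u ≤ v)
    (hγ : Set.Icc u v ⊆ A.dom γ)
    (hsent : ∃ a ∈ R, Set.Icc u v ⊆ A.dom a ∧ ∀ x ∈ Set.Icc u v, A.fn γ x < A.fn a x)
    (hcross : ∀ a ∈ R, ∀ x ∈ Set.Icc u v, x ∉ A.meet γ a)
    (hvis : ∀ e : ℝ × ℝ, e.1 ∈ Set.Icc u v → ¬ A.VisibleAbove R γ e) :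
    ∃ t ∈ R, ∀ x ∈ Set.Icc u v, x ∈ A.dom t ∧ A.fn γ x < A.fn t x ∧
      ∀ a ∈ R, a ≠ t → x ∈ A.dom a → A.fn γ x < A.fn a x → A.fn t x < A.fn a x := by
  let Q (x : ℝ) (t : ι) : Prop := t ∈ R ∧ x ∈ A.dom t ∧ A.fn γ x < A.fn t x ∧
      ∀ a ∈ R, a ≠ t → x ∈ A.dom a → A.fn γ x < A.fn a x → A.fn t x < A.fn a x
  have hlt : ∀ a ∈ R, ∀ x ∈ Set.Icc u v, x ∈ A.dom a → A.fn γ x ≤ A.fn a x →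
      A.fn γ x < A.fn a x := fun a ha x hx hxa h =>
    lt_of_le_of_ne h fun h' => hcross a ha x hx ⟨hγ hx, hxa, h'⟩
  have hex : ∀ x ∈ Set.Icc u v, ∃ t, Q x t := by
    intro x hx
    obtain ⟨s, hsR, hsd, hsl⟩ := hsent
    obtain ⟨t, ht, hmin⟩ := Finset.exists_min_image {a ∈ R | x ∈ A.dom a ∧ A.fn γ x < A.fn a x}
      (fun a => A.fn a x) ⟨s, Finset.mem_filter.2 ⟨hsR, hsd hx, hsl x hx⟩⟩
    rw [Finset.mem_filter] at ht
    refine ⟨t, ht.1, ht.2.1, ht.2.2, fun a ha hat hxa hlta => ?_⟩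
    refine lt_of_le_of_ne (hmin a (Finset.mem_filter.2 ⟨ha, hxa, hlta⟩)) fun heq => ?_
    refine hvis (x, A.fn t x) hx ⟨Or.inr ⟨t, ht.1, a, ha, Ne.symm hat, ⟨ht.2.1, rfl⟩,
      ⟨hxa, heq.symm⟩⟩, hγ hx, ht.2.2, fun b hb hxb hle => ?_⟩
    exact hmin b (Finset.mem_filter.2 ⟨hb, hxb, hlt b hb x hx hxb hle⟩)
  have huniq : ∀ x t t', Q x t → Q x t' → t = t' := by
    intro x t t' h h'
    by_contra hne
    exact lt_asymm (h.2.2.2 t' h'.1 (Ne.symm hne) h'.2.1 h'.2.2.1)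
      (h'.2.2.2 t h.1 hne h.2.1 h.2.2.1)
  have hopen : ∀ x ∈ Set.Icc u v, ∀ t, Q x t → ∀ᶠ y in nhds x, y ∈ Set.Icc u v → Q y t := by
    intro x hx t ht
    have hmin : ∀ b ∈ R, x ∈ A.dom b → A.fn γ x ≤ A.fn b x → A.fn t x ≤ A.fn b x := by
      intro b hb hxb hle
      by_cases hbt : b = t
      · rw [hbt]
      · exact (ht.2.2.2 b hb hbt hxb (hlt b hb x hx hxb hle)).le
    have hend : ¬ (x = A.left t ∨ x = A.right t) := fun h =>
      hvis (x, A.fn t x) hx ⟨Or.inl ⟨t, ht.1, ⟨ht.2.1, rfl⟩, h⟩, hγ hx, ht.2.2.1, hmin⟩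
    have hdom : ∀ᶠ y in nhds x, y ∈ A.dom t := by
      refine Icc_mem_nhds ?_ ?_
      · exact lt_of_le_of_ne ht.2.1.1 fun h => hend (Or.inl h.symm)
      · exact lt_of_le_of_ne ht.2.1.2 fun h => hend (Or.inr h)
    have hall : ∀ᶠ y in nhds x, ∀ a ∈ R, y ∈ Set.Icc u v → a ≠ t → y ∈ A.dom a → y ∈ A.dom t →
        A.fn γ y < A.fn a y → A.fn t y < A.fn a y := by
      rw [Filter.eventually_all_finset]
      intro a ha
      by_cases hxa : x ∈ A.dom a
      · rcases lt_or_ge (A.fn a x) (A.fn γ x) with h | h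
        · filter_upwards [A.eventually_fn_lt hxa (hγ hx) h] with y hy h1 _ h3 _ h5
          exact absurd (hy h3 (hγ h1)) (lt_asymm h5)
        · by_cases hat : a = t
          · exact Filter.Eventually.of_forall fun y _ h => absurd hat h
          · filter_upwards [A.eventually_fn_lt ht.2.1 hxa
              (ht.2.2.2 a ha hat hxa (hlt a ha x hx hxa h))] with y hy _ _ h3 h4 _
            exact hy h4 h3
      · filter_upwards [A.eventually_notMem_dom hxa] with y hy _ _ h3
        exact absurd h3 hy
    filter_upwards [hdom, hall, A.eventually_fn_lt (hγ hx) ht.2.1 ht.2.2.1] with y h1 h2 h3 hy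
    exact ⟨ht.1, h1, h3 (hγ hy) h1, fun a ha hat hya hl => h2 a ha hy hat hya h1 hl⟩
  have : Nonempty ι := ⟨γ⟩
  choose! f hf using hex
  have hloc : IsLocallyConstant fun x : Set.Icc u v => f x := by
    rw [IsLocallyConstant.iff_eventually_eq]
    intro x
    have h := hopen x x.2 (f x) (hf x x.2)
    have h' := (continuous_subtype_val.tendsto x).eventually h
    filter_upwards [h'] with y hy using huniq y _ _ (hf y y.2) (hy y.2)
  have : PreconnectedSpace (Set.Icc u v) :=
    isPreconnected_iff_preconnectedSpace.1 isPreconnected_Icc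
  have hu : u ∈ Set.Icc u v := Set.left_mem_Icc.2 huv
  refine ⟨f u, (hf u hu).1, fun x hx => ?_⟩
  have := hloc.apply_eq_of_preconnectedSpace ⟨u, hu⟩ ⟨x, hx⟩
  simp only at this
  rw [this]
  exact (hf x hx).2

/-- Two points of `γ` in different cells are separated by an intersection or a visible vertex. -/
lemma exists_separating {R : Finset ι} {γ : ι} {p q : ℝ × ℝ} (hp : A.On p γ) (hq : A.On q γ)
    (htop : ∃ a ∈ R, ∀ x ∈ A.dom γ, x ∈ A.dom a ∧ A.fn γ x < A.fn a x)
    (hbot : ∃ a ∈ R, ∀ x ∈ A.dom γ, x ∈ A.dom a ∧ A.fn a x < A.fn γ x)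
    (hrel : ¬ A.cellSetoid R p q) :
    ∃ x ∈ Set.uIcc p.1 q.1, (∃ a ∈ R, x ∈ A.meet γ a) ∨ (∃ y, A.VisibleAbove R γ (x, y)) ∨
      ∃ y, A.neg.VisibleAbove R γ (x, y) := by
  by_contra! hcon
  have hsub : Set.uIcc p.1 q.1 ⊆ A.dom γ := Set.uIcc_subset_Icc hp.1 hq.1
  have huv : min p.1 q.1 ≤ max p.1 q.1 := min_le_max
  obtain ⟨t, htR, ht⟩ := A.exists_lowest_above (R := R) (γ := γ) huv hsub
    (by obtain ⟨a, ha, h⟩ := htop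
        exact ⟨a, ha, fun x hx => (h x (hsub hx)).1, fun x hx => (h x (hsub hx)).2⟩)
    (fun a ha x hx => (hcon x hx).1 a ha) (fun e he => (hcon e.1 he).2.1 e.2)
  obtain ⟨b, hbR, hb⟩ := A.neg.exists_lowest_above (R := R) (γ := γ) huv hsub
    (by obtain ⟨a, ha, h⟩ := hbot
        exact ⟨a, ha, fun x hx => (h x (hsub hx)).1, fun x hx => by
          simpa using (h x (hsub hx)).2⟩)
    (fun a ha x hx => by rw [meet_neg]; exact (hcon x hx).1 a ha)
    (fun e he => (hcon e.1 he).2.2 e.2)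
  simp only [dom_neg, neg_fn, neg_lt_neg_iff] at hb
  refine hrel (Or.inr ⟨t, b, htR, hbR, fun x hx => (ht x hx).1, fun x hx => (hb x hx).1, ?_, ?_,
    ?_, ?_, ?_⟩)
  · rw [← hp.2]; exact (ht _ Set.left_mem_uIcc).2.1
  · rw [← hp.2]; exact (hb _ Set.left_mem_uIcc).2.1
  · rw [← hq.2]; exact (ht _ Set.right_mem_uIcc).2.1
  · rw [← hq.2]; exact (hb _ Set.right_mem_uIcc).2.1
  · intro a ha hat hab x hx hxa h1 h2
    rcases lt_trichotomy (A.fn γ x) (A.fn a x) with h | h | h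
    · exact absurd h2 (not_le.2 ((ht x hx).2.2 a ha hat hxa h))
    · exact (hcon x hx).1 a ha ⟨hsub hx, hxa, h⟩
    · exact absurd h1 (not_le.2 ((hb x hx).2.2 a ha hab hxa h))

end ArcFamily

/-- If any two points of `W` are separated by a point of `E`, then `W` is at most twice as large
as `E`, up to one point. -/
lemma card_le_of_separated {W E : Finset ℝ}
    (h : ∀ w ∈ W, ∀ w' ∈ W, w < w' → ∃ e ∈ E, w ≤ e ∧ e ≤ w') : #W ≤ 2 * #E + 1 := by
  rcases W.eq_empty_or_nonempty with rfl | hW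
  · simp
  set m := W.max' hW
  have hex : ∀ w ∈ W.erase m, ∃ e ∈ E, w ≤ e ∧ ∀ e' ∈ E, w ≤ e' → e ≤ e' := by
    intro w hw
    rw [Finset.mem_erase] at hw
    obtain ⟨e, he, hwe, _⟩ := h w hw.2 m (W.max'_mem hW) (lt_of_le_of_ne (W.le_max' w hw.2) hw.1)
    obtain ⟨e, he, hmin⟩ := Finset.exists_min_image {e ∈ E | w ≤ e} id
      ⟨e, Finset.mem_filter.2 ⟨he, hwe⟩⟩
    rw [Finset.mem_filter] at he
    exact ⟨e, he.1, he.2, fun e' he' hle => hmin e' (Finset.mem_filter.2 ⟨he', hle⟩)⟩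
  choose! f hfE hfle hfmin using hex
  have hfib : ∀ e ∈ E, #{w ∈ W.erase m | f w = e} ≤ 2 := by
    intro e _
    by_contra! hc
    obtain ⟨a, b, c, ha, hb, hc, hab, hac, hbc⟩ := Finset.two_lt_card_iff.1 hc
    have key : ∀ x y z : ℝ, x ∈ ({w ∈ W.erase m | f w = e} : Finset ℝ) →
        y ∈ ({w ∈ W.erase m | f w = e} : Finset ℝ) →
        z ∈ ({w ∈ W.erase m | f w = e} : Finset ℝ) → x < y → y < z → False := by
      intro x y z hx hy hz hxy hyz
      rw [Finset.mem_filter] at hx hy hz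
      obtain ⟨e', he', h1, h2⟩ := h x (Finset.mem_of_mem_erase hx.1) y
        (Finset.mem_of_mem_erase hy.1) hxy
      have h3 := hfmin x hx.1 e' he' h1
      have h4 := hfle z hz.1
      rw [hx.2] at h3
      rw [hz.2] at h4
      linarith
    rcases lt_or_gt_of_ne hab with h1 | h1 <;> rcases lt_or_gt_of_ne hac with h2 | h2 <;>
      rcases lt_or_gt_of_ne hbc with h3 | h3
    · exact key a b c ha hb hc h1 h3
    · exact key a c b ha hc hb h2 h3
    · exact lt_asymm (h1.trans h3) h2
    · exact key c a b hc ha hb h2 h1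
    · exact key b a c hb ha hc h1 h2
    · exact lt_asymm (h1.trans h2) h3
    · exact key b c a hb hc ha h3 h2
    · exact key c b a hc hb ha h3 h1
  have h1 := Finset.card_le_mul_card_image_of_maps_to (f := f) (s := W.erase m) (t := E)
    (fun w hw => hfE w hw) 2 hfib
  have h2 : #(W.erase m) + 1 = #W := Finset.card_erase_add_one (W.max'_mem hW)
  omega

namespace ArcFamily

variable {ι : Type*} (A : ArcFamily ι)

/-- The vertices of the arrangement of `S`, as a finite set. -/
def vertices (S : Finset ι) : Finset (ℝ × ℝ) :=
  S.image (fun a => (A.left a, A.fn a (A.left a))) ∪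
    S.image (fun a => (A.right a, A.fn a (A.right a))) ∪
    S.offDiag.biUnion fun ab => if h : (A.meet ab.1 ab.2).Finite then
      h.toFinset.image fun x => (x, A.fn ab.1 x) else ∅

lemma IsVertex.mem_vertices {A : ArcFamily ι} {S : Finset ι} {e : ℝ × ℝ}
    (hfin : ∀ a ∈ S, ∀ b ∈ S, a ≠ b → (A.meet a b).Finite) (h : A.IsVertex S e) :
    e ∈ A.vertices S := by
  unfold vertices
  simp only [Finset.mem_union, Finset.mem_image, Finset.mem_biUnion]
  rcases h with ⟨a, ha, hon, h | h⟩ | ⟨a, ha, b, hb, hab, hon, hon'⟩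
  · exact Or.inl (Or.inl ⟨a, ha, Prod.ext h.symm (by rw [← h]; exact hon.2)⟩)
  · exact Or.inl (Or.inr ⟨a, ha, Prod.ext h.symm (by rw [← h]; exact hon.2)⟩)
  · refine Or.inr ⟨(a, b), Finset.mem_offDiag.2 ⟨ha, hb, hab⟩, ?_⟩
    rw [dif_pos (hfin a ha b hb hab), Finset.mem_image]
    exact ⟨e.1, (Set.Finite.mem_toFinset _).2 ⟨hon.1, hon'.1, hon.2.trans hon'.2.symm⟩,
      Prod.ext rfl hon.2⟩

lemma card_vertices_le {S : Finset ι} {M : ℕ}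
    (hM : ∀ a ∈ S, ∀ b ∈ S, a ≠ b → (A.meet a b).Finite ∧ (A.meet a b).ncard ≤ M) :
    #(A.vertices S) ≤ 2 * #S + M * #S ^ 2 := by
  unfold vertices
  refine (Finset.card_union_le _ _).trans ?_
  refine add_le_add ((Finset.card_union_le _ _).trans ?_) ?_
  · rw [two_mul]; exact add_le_add Finset.card_image_le Finset.card_image_le
  · refine (Finset.card_biUnion_le_card_mul _ _ M fun ab hab => ?_).trans ?_
    · rw [Finset.mem_offDiag] at hab
      obtain ⟨h, hle⟩ := hM _ hab.1 _ hab.2.1 hab.2.2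
      rw [dif_pos h]
      refine Finset.card_image_le.trans ?_
      rwa [← Set.ncard_eq_toFinset_card _ h]
    · rw [Finset.offDiag_card, mul_comm, sq]
      exact Nat.mul_le_mul_left _ (Nat.sub_le _ _)

/-- A vertex is visible from at most one arc below it. -/
lemma sum_card_visibleAbove_le (T S : Finset ι) (hS : S ⊆ T) (U : Finset (ℝ × ℝ)) :
    ∑ γ ∈ S, #{e ∈ U | A.VisibleAbove (T.erase γ) γ e} ≤ #U := by
  have := Finset.sum_card_bipartiteAbove_eq_sum_card_bipartiteBelow
    (s := S) (t := U) (fun γ e => A.VisibleAbove (T.erase γ) γ e)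
  simp only [Finset.bipartiteAbove, Finset.bipartiteBelow] at this
  rw [this]
  refine (Finset.sum_le_card_nsmul _ _ 1 fun e _ => ?_).trans (by simp)
  rw [Finset.card_le_one]
  have key : ∀ γ₁ ∈ S, ∀ γ₂ ∈ S, A.VisibleAbove (T.erase γ₁) γ₁ e →
      A.VisibleAbove (T.erase γ₂) γ₂ e → γ₁ ≠ γ₂ → A.fn γ₁ e.1 ≤ A.fn γ₂ e.1 → False :=
    fun γ₁ _ γ₂ h2 hv1 hv2 hne hle => not_lt.2
      (hv1.le γ₂ (Finset.mem_erase.2 ⟨Ne.symm hne, hS h2⟩) hv2.mem_dom hle) hv2.lt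
  intro γ₁ h1 γ₂ h2
  rw [Finset.mem_filter] at h1 h2
  by_contra hne
  rcases le_total (A.fn γ₁ e.1) (A.fn γ₂ e.1) with h | h
  · exact key γ₁ h1.1 γ₂ h2.1 h1.2 h2.2 hne h
  · exact key γ₂ h2.1 γ₁ h1.1 h2.2 h1.2 (Ne.symm hne) h

/-- The abscissae at which `γ` may pass from one cell to another. -/
def breaks (T : Finset ι) (γ : ι) : Finset ℝ :=
  ((T.erase γ).biUnion fun a => if h : (A.meet γ a).Finite then h.toFinset else ∅) ∪
    {e ∈ A.vertices T | A.VisibleAbove (T.erase γ) γ e}.image Prod.fst ∪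
    {e ∈ A.neg.vertices T | A.neg.VisibleAbove (T.erase γ) γ e}.image Prod.fst

lemma IsVertex.mono {A : ArcFamily ι} {S T : Finset ι} (hST : S ⊆ T) {e : ℝ × ℝ}
    (h : A.IsVertex S e) : A.IsVertex T e := by
  rcases h with ⟨a, ha, h⟩ | ⟨a, ha, b, hb, h⟩
  · exact Or.inl ⟨a, hST ha, h⟩
  · exact Or.inr ⟨a, hST ha, b, hST hb, h⟩

lemma sum_card_breaks_le {T S : Finset ι} (hS : S ⊆ T) {M : ℕ}
    (hM : ∀ a ∈ T, ∀ b ∈ T, a ≠ b → (A.meet a b).Finite ∧ (A.meet a b).ncard ≤ M) :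
    ∑ γ ∈ S, #(A.breaks T γ) ≤ 4 * #T + 3 * (M * #T ^ 2) := by
  have h1 : ∀ γ ∈ S, #(A.breaks T γ) ≤ #T * M +
      #{e ∈ A.vertices T | A.VisibleAbove (T.erase γ) γ e} +
      #{e ∈ A.neg.vertices T | A.neg.VisibleAbove (T.erase γ) γ e} := by
    intro γ hγ
    refine (Finset.card_union_le _ _).trans (add_le_add ((Finset.card_union_le _ _).trans
      (add_le_add ?_ Finset.card_image_le)) Finset.card_image_le)
    refine (Finset.card_biUnion_le_card_mul _ _ M fun a ha => ?_).trans
      (Nat.mul_le_mul_right _ (Finset.card_le_card (Finset.erase_subset _ _)))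
    rw [Finset.mem_erase] at ha
    obtain ⟨h, hle⟩ := hM γ (hS hγ) a ha.2 (Ne.symm ha.1)
    rw [dif_pos h]
    rwa [← Set.ncard_eq_toFinset_card _ h]
  refine (Finset.sum_le_sum h1).trans ?_
  rw [Finset.sum_add_distrib, Finset.sum_add_distrib, Finset.sum_const, smul_eq_mul]
  have h2 := (A.sum_card_visibleAbove_le T S hS (A.vertices T)).trans (A.card_vertices_le hM)
  have h3 := (A.neg.sum_card_visibleAbove_le T S hS (A.neg.vertices T)).trans
    (A.neg.card_vertices_le (by simpa using hM))
  have h4 : #S * (#T * M) ≤ M * #T ^ 2 := by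
    calc #S * (#T * M) ≤ #T * (#T * M) := Nat.mul_le_mul_right _ (Finset.card_le_card hS)
      _ = M * #T ^ 2 := by ring
  omega

/-- An arc meets few cells. -/
lemma cellCount_le {T : Finset ι} {γ : ι} (V : Finset (ℝ × ℝ)) (R' : Finset ι) (hγ : γ ∈ T)
    (hfin : ∀ a ∈ T, ∀ b ∈ T, a ≠ b → (A.meet a b).Finite)
    (htop : ∃ a ∈ T.erase γ, ∀ x ∈ A.dom γ, x ∈ A.dom a ∧ A.fn γ x < A.fn a x)
    (hbot : ∃ a ∈ T.erase γ, ∀ x ∈ A.dom γ, x ∈ A.dom a ∧ A.fn a x < A.fn γ x) :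
    #(({q ∈ freePoints A.On V R' | A.On q γ}).image (Quotient.mk (A.cellSetoid (T.erase γ))))
      ≤ 2 * #(A.breaks T γ) + 1 := by
  set Q := ({q ∈ freePoints A.On V R' | A.On q γ} : Finset (ℝ × ℝ))
  set c : ℝ × ℝ → Quotient (A.cellSetoid (T.erase γ)) := Quotient.mk _ with hc
  obtain ⟨Q', hQ', himg, hinj⟩ : ∃ Q' ⊆ Q, Q'.image c = Q.image c ∧ Set.InjOn c Q' := by
    obtain ⟨u, hu, hinj, himg⟩ := Finset.exists_subset_injOn_image_eq_of_surjOn (f := c)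
      (Q : Set (ℝ × ℝ)) (Q.image c) (by rw [Finset.coe_image]; exact Set.surjOn_image _ _)
    exact ⟨u, by exact_mod_cast hu, himg, hinj⟩
  have hon : ∀ q ∈ Q', A.On q γ := fun q hq => (Finset.mem_filter.1 (hQ' hq)).2
  have hfst : Set.InjOn Prod.fst (Q' : Set (ℝ × ℝ)) := by
    intro p hp q hq h
    exact Prod.ext h (by rw [← (hon p hp).2, ← (hon q hq).2, h])
  rw [← himg, Finset.card_image_of_injOn hinj, ← Finset.card_image_of_injOn hfst]
  refine card_le_of_separated ?_
  intro w hw w' hw' hlt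
  rw [Finset.mem_image] at hw hw'
  obtain ⟨p, hp, rfl⟩ := hw
  obtain ⟨q, hq, rfl⟩ := hw'
  have hrel : ¬ A.cellSetoid (T.erase γ) p q := by
    intro h
    have := hinj hp hq (Quotient.sound h)
    exact hlt.ne (by rw [this])
  obtain ⟨x, hx, h⟩ := A.exists_separating (hon p hp) (hon q hq) htop hbot hrel
  rw [Set.uIcc_of_le hlt.le] at hx
  refine ⟨x, ?_, hx.1, hx.2⟩
  unfold breaks
  simp only [Finset.mem_union, Finset.mem_image, Finset.mem_biUnion, Finset.mem_filter]
  rcases h with ⟨a, ha, h⟩ | ⟨y, h⟩ | ⟨y, h⟩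
  · refine Or.inl (Or.inl ⟨a, ha, ?_⟩)
    rw [Finset.mem_erase] at ha
    rw [dif_pos (hfin γ hγ a ha.2 (Ne.symm ha.1)), Set.Finite.mem_toFinset]
    exact h
  · exact Or.inl (Or.inr ⟨(x, y), ⟨(h.isVertex.mono (Finset.erase_subset _ _)).mem_vertices hfin,
      h⟩, rfl⟩)
  · exact Or.inr ⟨(x, y), ⟨(h.isVertex.mono (Finset.erase_subset _ _)).mem_vertices
      (by simpa using hfin), h⟩, rfl⟩

end ArcFamily

namespace ArcFamily

variable {ι : Type*} (A : ArcFamily ι)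

/-- The incidence bound for arcs, in the presence of an arc `t` above and an arc `b` below
everything else. -/
lemma incidenceCount_le_of_sentinels (V : Finset (ℝ × ℝ)) (Γ : Finset ι) {t b : ι}
    (ht : t ∉ Γ) (hb : b ∉ Γ) (hlt : ∀ x, A.fn b x < A.fn t x)
    (htop : ∀ p, (p ∈ V ∨ ∃ a ∈ Γ, A.On p a) → p.1 ∈ A.dom t ∧ p.2 < A.fn t p.1)
    (hbot : ∀ p, (p ∈ V ∨ ∃ a ∈ Γ, A.On p a) → p.1 ∈ A.dom b ∧ A.fn b p.1 < p.2)
    {k s M : ℕ} (hk : 2 ≤ k)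
    (hM : ∀ a ∈ Γ, ∀ b ∈ Γ, a ≠ b → (A.meet a b).Finite ∧ (A.meet a b).ncard ≤ M)
    (hs : ∀ T ⊆ V, #T = k → #{γ ∈ Γ | ∀ p ∈ T, A.On p γ} ≤ s) :
    (incidenceCount A.On V Γ : ℝ) ≤
      (k + 2 + 3 * s + 9 * M + 2 * (M + 2 * k * (25 + 54 * M : ℕ)) + 4 * 5) *
      ((#V : ℝ) ^ ((k : ℝ) / (2 * k - 1)) * (#Γ : ℝ) ^ ((2 * (k : ℝ) - 2) / (2 * k - 1))
        + #V + #Γ) := by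
  have hk1 : 1 ≤ k := by omega
  have hM' : ∀ γ ∈ Γ, ∀ γ' ∈ Γ, γ ≠ γ' → #{p ∈ V | A.On p γ ∧ A.On p γ'} ≤ M := by
    intro γ hγ γ' hγ' hne
    obtain ⟨hf, hc⟩ := hM γ hγ γ' hγ' hne
    refine le_trans ?_ hc
    rw [Set.ncard_eq_toFinset_card _ hf]
    refine Finset.card_le_card_of_injOn Prod.fst ?_ ?_
    · intro p hp
      have hp := (Finset.mem_filter.1 hp).2
      simpa using ⟨hp.1.1, hp.2.1, hp.1.2.trans hp.2.2.symm⟩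
    · intro p hp q hq h
      have hp := (Finset.mem_filter.1 hp).2
      have hq := (Finset.mem_filter.1 hq).2
      exact Prod.ext h (by rw [← hp.1.2, ← hq.1.2, h])
  have hMT : ∀ S ⊆ Γ, ∀ a ∈ S ∪ {t, b}, ∀ a' ∈ S ∪ {t, b}, a ≠ a' →
      (A.meet a a').Finite ∧ (A.meet a a').ncard ≤ M := by
    have hempty : ∀ X : Set ℝ, (∀ x, x ∉ X) → X.Finite ∧ X.ncard ≤ M := by
      intro X hX
      rw [Set.eq_empty_of_forall_notMem hX]
      simp
    intro S hS a ha a' ha' hne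
    simp only [Finset.mem_union, Finset.mem_insert, Finset.mem_singleton] at ha ha'
    rcases ha with ha | rfl | rfl <;> rcases ha' with ha' | rfl | rfl
    · exact hM a (hS ha) a' (hS ha') hne
    · exact hempty _ fun x hx => (htop (x, A.fn a x) (Or.inr ⟨a, hS ha, hx.1, rfl⟩)).2.ne hx.2.2
    · exact hempty _ fun x hx => (hbot (x, A.fn a x) (Or.inr ⟨a, hS ha, hx.1, rfl⟩)).2.ne' hx.2.2
    · exact hempty _ fun x hx =>
        (htop (x, A.fn a' x) (Or.inr ⟨a', hS ha', hx.2.1, rfl⟩)).2.ne' hx.2.2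
    · exact absurd rfl hne
    · exact hempty _ fun x hx => (hlt x).ne' hx.2.2
    · exact hempty _ fun x hx =>
        (hbot (x, A.fn a' x) (Or.inr ⟨a', hS ha', hx.2.1, rfl⟩)).2.ne hx.2.2
    · exact hempty _ fun x hx => (hlt x).ne hx.2.2
    · exact absurd rfl hne
  have herase : ∀ S ⊆ Γ, ∀ γ ∈ S, (S ∪ {t, b}).erase γ = S.erase γ ∪ {t, b} := by
    intro S hS γ hγ
    rw [Finset.erase_union_distrib, Finset.erase_eq_of_notMem (s := {t, b})]
    simp only [Finset.mem_insert, Finset.mem_singleton, not_or]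
    exact ⟨fun h => ht (h ▸ hS hγ), fun h => hb (h ▸ hS hγ)⟩
  have htT : ∀ S : Finset ι, t ∈ S ∪ {t, b} := fun S => by simp
  have hbT : ∀ S : Finset ι, b ∈ S ∪ {t, b} := fun S => by simp
  have hD₁ : ∀ S ⊆ Γ, ∀ p ∈ V, #{γ ∈ S | p ∈ freePoints A.On V (S.erase γ) ∧
      ∃ q ∈ freePoints A.On V (S.erase γ), A.On q γ ∧
        A.cellSetoid (S.erase γ ∪ {t, b}) p q} ≤ 5 := by
    intro S hS p hp
    have h1 := htop p (Or.inl hp)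
    have h2 := hbot p (Or.inl hp)
    refine le_trans (Finset.card_le_card ?_) (A.card_conflict_le (S ∪ {t, b}) p
      ⟨t, htT S, h1⟩ ⟨b, hbT S, h2⟩)
    intro γ hγ
    rw [Finset.mem_filter] at hγ ⊢
    obtain ⟨hγS, hfree, q, -, hq, hrel⟩ := hγ
    refine ⟨Finset.mem_union_left _ hγS, fun a ha hon => ?_, q, hq, ?_⟩
    · rw [herase S hS γ hγS] at ha
      simp only [Finset.mem_union, Finset.mem_insert, Finset.mem_singleton] at ha
      rcases ha with ha | rfl | rfl
      · exact (Finset.mem_filter.1 hfree).2 a ha hon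
      · exact h1.2.ne hon.2.symm
      · exact h2.2.ne hon.2
    · rw [herase S hS γ hγS]; exact hrel
  have hD₂ : ∀ S ⊆ Γ, ∑ γ ∈ S, cellCount A.On (fun R => A.cellSetoid (R ∪ {t, b})) V
      (S.erase γ) γ ≤ (25 + 54 * M) * #S ^ 2 := by
    intro S hS
    rcases S.eq_empty_or_nonempty with rfl | hne
    · simp
    have h1 : ∀ γ ∈ S, cellCount A.On (fun R => A.cellSetoid (R ∪ {t, b})) V (S.erase γ) γ ≤
        2 * #(A.breaks (S ∪ {t, b}) γ) + 1 := by
      intro γ hγ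
      have := A.cellCount_le (T := S ∪ {t, b}) V (S.erase γ) (Finset.mem_union_left _ hγ)
        (fun a ha b hb hab => (hMT S hS a ha b hb hab).1)
        ⟨t, by rw [herase S hS γ hγ]; exact htT _, fun x hx =>
          htop (x, A.fn γ x) (Or.inr ⟨γ, hS hγ, hx, rfl⟩)⟩
        ⟨b, by rw [herase S hS γ hγ]; exact hbT _, fun x hx =>
          hbot (x, A.fn γ x) (Or.inr ⟨γ, hS hγ, hx, rfl⟩)⟩
      rw [herase S hS γ hγ] at this
      exact this
    have h2 := A.sum_card_breaks_le (T := S ∪ {t, b}) (S := S) Finset.subset_union_left (hMT S hS)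
    have h3 : #(S ∪ {t, b}) ≤ 3 * #S := by
      have := Finset.card_union_le S {t, b}
      have h5 : #({t, b} : Finset ι) ≤ 2 := Finset.card_le_two
      have := hne.card_pos
      omega
    refine (Finset.sum_le_sum h1).trans ?_
    rw [Finset.sum_add_distrib, ← Finset.mul_sum]
    simp only [Finset.sum_const, smul_eq_mul, mul_one]
    have h4 : #(S ∪ {t, b}) ^ 2 ≤ 9 * #S ^ 2 := by nlinarith
    have h5 : #S ≤ #S ^ 2 := Nat.le_self_pow (by norm_num) _
    have h6 := Nat.mul_le_mul_left M h4
    nlinarith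
  have hmain := le_of_sampling_bounds (k := k) (s := s) (M := M) (m := #V) (N := #Γ)
    (A := M + 2 * k * (25 + 54 * M : ℕ)) (D := (5 : ℕ)) (I := incidenceCount A.On V Γ) hk
    (by positivity) (by positivity)
    (fun a ha => incidenceCount_le_linear V Γ hk1 hs ha)
    (by exact_mod_cast incidenceCount_le_card_add_sq V Γ hM')
    (fun a ha r hr hrN => incidenceCount_le_of_sampling _ V Γ hM' hk1 hs
      (fun S hS p hp => by convert hD₁ S hS p hp) hD₂ ha hr hrN)
  exact_mod_cast hmain

/-- The family `A` with two horizontal arcs of heights `B` and `-B` over `[L, R]` added. -/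
def withSentinels (L R B : ℝ) : ArcFamily (ι ⊕ Bool) where
  left := Sum.elim A.left fun _ => L
  right := Sum.elim A.right fun _ => R
  fn := Sum.elim A.fn fun i _ => if i then B else -B
  continuousOn := by
    rintro (a | i)
    · exact A.continuousOn a
    · exact continuousOn_const

/-- The Pach–Sharir incidence bound for points and arcs. -/
theorem incidenceCount_le (V : Finset (ℝ × ℝ)) (Γ : Finset ι) {k s M : ℕ} (hk : 2 ≤ k)
    (hM : ∀ a ∈ Γ, ∀ b ∈ Γ, a ≠ b → (A.meet a b).Finite ∧ (A.meet a b).ncard ≤ M)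
    (hs : ∀ T ⊆ V, #T = k → #{γ ∈ Γ | ∀ p ∈ T, A.On p γ} ≤ s) :
    (incidenceCount A.On V Γ : ℝ) ≤
      (k + 2 + 3 * s + 9 * M + 2 * (M + 2 * k * (25 + 54 * M : ℕ)) + 4 * 5) *
      ((#V : ℝ) ^ ((k : ℝ) / (2 * k - 1)) * (#Γ : ℝ) ^ ((2 * (k : ℝ) - 2) / (2 * k - 1))
        + #V + #Γ) := by
  let X : Set (ℝ × ℝ) := V ∪ ⋃ a ∈ Γ, (fun x => (x, A.fn a x)) '' A.dom a
  have hX : IsCompact X := by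
    refine V.finite_toSet.isCompact.union (Γ.isCompact_biUnion fun a _ => ?_)
    exact isCompact_Icc.image_of_continuousOn (continuousOn_id.prodMk (A.continuousOn a))
  obtain ⟨B, hB⟩ := hX.isBounded.exists_norm_le
  have hXm : ∀ p, (p ∈ V ∨ ∃ a ∈ Γ, A.On p a) → |p.1| ≤ B ∧ |p.2| ≤ B := by
    intro p hp
    have : p ∈ X := by
      rcases hp with hp | ⟨a, ha, h⟩
      · exact Or.inl hp
      · exact Or.inr (Set.mem_biUnion ha ⟨p.1, h.1, Prod.ext rfl h.2⟩)
    have := hB p this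
    rw [Prod.norm_def] at this
    exact ⟨(le_max_left _ _).trans this, (le_max_right _ _).trans this⟩
  have hB' : ∀ p, (p ∈ V ∨ ∃ a ∈ Γ, A.On p a) → 0 ≤ B := fun p hp =>
    (abs_nonneg _).trans (hXm p hp).1
  set A' := A.withSentinels (-B) B (|B| + 1)
  have hon : ∀ p, (p ∈ V ∨ ∃ a ∈ Γ.map Function.Embedding.inl, A'.On p a) →
      (p ∈ V ∨ ∃ a ∈ Γ, A.On p a) := by
    rintro p (hp | ⟨a, ha, h⟩)
    · exact Or.inl hp
    · obtain ⟨a, ha', rfl⟩ := Finset.mem_map.1 ha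
      exact Or.inr ⟨a, ha', h⟩
  have := A'.incidenceCount_le_of_sentinels V (Γ.map Function.Embedding.inl)
    (t := Sum.inr true) (b := Sum.inr false) (k := k) (s := s) (M := M) (by simp) (by simp)
    (fun x => by
      change (if false then |B| + 1 else -(|B| + 1)) < (if true then |B| + 1 else -(|B| + 1))
      have := abs_nonneg B
      simp only [Bool.false_eq_true, if_false, if_true]
      linarith)
    (fun p hp => by
      obtain ⟨h1, h2⟩ := hXm p (hon p hp)
      refine ⟨abs_le.1 h1, ?_⟩
      change p.2 < (if true then |B| + 1 else -(|B| + 1))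
      simp only [if_true]
      linarith [(abs_le.1 h2).2, le_abs_self B])
    (fun p hp => by
      obtain ⟨h1, h2⟩ := hXm p (hon p hp)
      refine ⟨abs_le.1 h1, ?_⟩
      change (if false then |B| + 1 else -(|B| + 1)) < p.2
      simp only [Bool.false_eq_true, if_false]
      linarith [(abs_le.1 h2).1, le_abs_self B])
    hk
    (by
      intro a ha b hb hab
      obtain ⟨a, ha', rfl⟩ := Finset.mem_map.1 ha
      obtain ⟨b, hb', rfl⟩ := Finset.mem_map.1 hb
      exact hM a ha' b hb' fun h => hab (by rw [h]))
    (by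
      intro T hT hTk
      rw [Finset.filter_map, Finset.card_map]
      exact hs T hT hTk)
  have hcount : incidenceCount A'.On V (Γ.map Function.Embedding.inl)
      = incidenceCount A.On V Γ := by
    unfold incidenceCount
    rw [Finset.sum_map]
    rfl
  rw [hcount, Finset.card_map] at this
  exact this

end ArcFamily

section LocalRoots

lemma exists_root_of_mul_neg {f : ℝ → ℝ} (hf : Continuous f) {a b : ℝ} (hab : a ≤ b)
    (h : f a * f b < 0) : ∃ y ∈ Set.Ioo a b, f y = 0 := by
  rcases mul_neg_iff.1 h with ⟨ha, hb⟩ | ⟨ha, hb⟩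
  · exact intermediate_value_Ioo' hab hf.continuousOn ⟨hb, ha⟩
  · exact intermediate_value_Ioo hab hf.continuousOn ⟨ha, hb⟩

lemma injOn_of_deriv_ne_zero {f g : ℝ → ℝ} (hfg : ∀ y, HasDerivAt f (g y) y) {a b : ℝ}
    (h : ∀ y ∈ Set.Icc a b, g y ≠ 0) : Set.InjOn f (Set.Icc a b) := by
  have hcont : Continuous f := continuous_iff_continuousAt.2 fun y => (hfg y).continuousAt
  have key : ∀ u ∈ Set.Icc a b, ∀ v ∈ Set.Icc a b, u < v → f u ≠ f v := by
    intro u hu v hv huv heq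
    obtain ⟨c, hc, hc'⟩ := exists_hasDerivAt_eq_zero huv hcont.continuousOn heq fun x _ => hfg x
    exact h c ⟨hu.1.trans hc.1.le, hc.2.le.trans hv.2⟩ hc'
  intro u hu v hv heq
  by_contra hne
  rcases lt_or_gt_of_ne hne with h | h
  · exact key u hu v hv h heq
  · exact key v hv u hu h heq.symm

/-- Simple zeros depend continuously on the parameter, and no zero appears or disappears. -/
lemma eventually_exists_root_bijection {F G : ℝ × ℝ → ℝ} (hF : Continuous F) (hG : Continuous G)
    (hFG : ∀ x y, HasDerivAt (fun y => F (x, y)) (G (x, y)) y) {x₀ : ℝ} {Z : Finset ℝ}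
    (hZ : ∀ y, F (x₀, y) = 0 ↔ y ∈ Z) (hsimple : ∀ z ∈ Z, G (x₀, z) ≠ 0)
    {B : ℝ} (hB : ∀ᶠ x in nhds x₀, ∀ y, F (x, y) = 0 → y ∈ Set.Icc (-B) B)
    {ε : ℝ} (hε : 0 < ε) :
    ∀ᶠ x in nhds x₀, ∃ r : ℝ → ℝ, StrictMonoOn r Z ∧ (∀ y, F (x, y) = 0 ↔ ∃ z ∈ Z, r z = y) ∧
      ∀ z ∈ Z, |r z - z| < ε := by
  have hFx : ∀ x, Continuous fun y => F (x, y) := fun x => hF.comp (Continuous.prodMk_right x)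
  obtain ⟨δ, hδ, hδε, hsep, hGδ⟩ : ∃ δ > 0, δ < ε ∧
      (∀ z ∈ Z, ∀ z' ∈ Z, z < z' → z + δ < z' - δ) ∧
      ∀ z ∈ Z, ∀ y ∈ Set.Icc (z - δ) (z + δ), G (x₀, y) ≠ 0 := by
    have e1 : ∀ᶠ δ in nhdsWithin (0 : ℝ) (Set.Ioi 0), δ < ε :=
      eventually_nhdsWithin_of_eventually_nhds (eventually_lt_nhds hε)
    have e2 : ∀ᶠ δ in nhdsWithin (0 : ℝ) (Set.Ioi 0), ∀ z ∈ Z, ∀ z' ∈ Z, z < z' →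
        z + δ < z' - δ := by
      rw [Filter.eventually_all_finset]
      intro z _
      rw [Filter.eventually_all_finset]
      intro z' _
      by_cases h : z < z'
      · have : (0 : ℝ) < (z' - z) / 2 := by linarith
        filter_upwards [eventually_nhdsWithin_of_eventually_nhds (eventually_lt_nhds this)]
          with δ hδ _
        linarith
      · exact Filter.Eventually.of_forall fun _ h' => absurd h' h
    have e3 : ∀ᶠ δ in nhdsWithin (0 : ℝ) (Set.Ioi 0), ∀ z ∈ Z, ∀ y ∈ Set.Icc (z - δ) (z + δ),
        G (x₀, y) ≠ 0 := by
      rw [Filter.eventually_all_finset]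
      intro z hz
      have : ∀ᶠ y in nhds z, G (x₀, y) ≠ 0 :=
        (hG.comp (Continuous.prodMk_right x₀)).continuousAt.eventually_ne (hsimple z hz)
      obtain ⟨η, hη, h⟩ := Metric.eventually_nhds_iff.1 this
      filter_upwards [eventually_nhdsWithin_of_eventually_nhds (eventually_lt_nhds hη)]
        with δ hδ y hy
      refine h ?_
      rw [Real.dist_eq]
      exact lt_of_le_of_lt (abs_le.2 ⟨by linarith [hy.1], by linarith [hy.2]⟩) hδ
    obtain ⟨δ, h1, h2, h3, h4⟩ := (e1.and (e2.and (e3.and self_mem_nhdsWithin))).exists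
    exact ⟨δ, h4, h1, h2, h3⟩
  have ev1 : ∀ᶠ x in nhds x₀, ∀ z ∈ Z, ∀ y ∈ Set.Icc (z - δ) (z + δ), G (x, y) ≠ 0 := by
    rw [Filter.eventually_all_finset]
    intro z hz
    refine isCompact_Icc.eventually_forall_of_forall_eventually fun y hy => ?_
    exact hG.continuousAt.eventually_ne (hGδ z hz y hy)
  have ev2 : ∀ᶠ x in nhds x₀, ∀ z ∈ Z, F (x, z - δ) * F (x, z + δ) < 0 := by
    rw [Filter.eventually_all_finset]
    intro z hz
    have hc : Continuous fun x => F (x, z - δ) * F (x, z + δ) :=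
      (hF.comp (Continuous.prodMk_left _)).mul (hF.comp (Continuous.prodMk_left _))
    refine hc.continuousAt.eventually_lt continuousAt_const ?_
    have hinj := injOn_of_deriv_ne_zero (hFG x₀) (hGδ z hz)
    have hz0 : F (x₀, z) = 0 := (hZ z).2 hz
    have hm : z ∈ Set.Icc (z - δ) (z + δ) := ⟨by linarith, by linarith⟩
    have hl : z - δ ∈ Set.Icc (z - δ) (z + δ) := ⟨le_rfl, by linarith⟩
    have hr : z + δ ∈ Set.Icc (z - δ) (z + δ) := ⟨by linarith, le_rfl⟩
    rcases ContinuousOn.strictMonoOn_of_injOn_Icc' (by linarith : z - δ ≤ z + δ)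
      (hFx x₀).continuousOn hinj with h | h
    · have h1 := h hl hm (by linarith)
      have h2 := h hm hr (by linarith)
      simp only [hz0] at h1 h2
      exact mul_neg_of_neg_of_pos h1 h2
    · have h1 := h hl hm (by linarith)
      have h2 := h hm hr (by linarith)
      simp only [hz0] at h1 h2
      exact mul_neg_of_pos_of_neg h1 h2
  have ev3 : ∀ᶠ x in nhds x₀, ∀ y ∈ Set.Icc (-B) B \ ⋃ z ∈ Z, Set.Ioo (z - δ) (z + δ),
      F (x, y) ≠ 0 := by
    refine (isCompact_Icc.diff (isOpen_biUnion fun z _ => isOpen_Ioo)).eventually_forall_of_forall_eventually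
      fun y hy => hF.continuousAt.eventually_ne fun h0 => hy.2 ?_
    exact Set.mem_biUnion ((hZ y).1 h0) ⟨by linarith, by linarith⟩
  filter_upwards [ev1, ev2, ev3, hB] with x h1 h2 h3 h4
  have hroot : ∀ z ∈ Z, ∃ y ∈ Set.Ioo (z - δ) (z + δ), F (x, y) = 0 := fun z hz =>
    exists_root_of_mul_neg (hFx x) (by linarith) (h2 z hz)
  choose! r hr hr0 using hroot
  refine ⟨r, ?_, ?_, ?_⟩
  · intro z hz z' hz' hlt
    have := hsep z hz z' hz' hlt
    linarith [(hr z hz).2, (hr z' hz').1]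
  · intro y
    constructor
    · intro hy
      have hyU : y ∈ ⋃ z ∈ Z, Set.Ioo (z - δ) (z + δ) := by
        by_contra hn
        exact h3 y ⟨h4 y hy, hn⟩ hy
      obtain ⟨z, hz, hyz⟩ := Set.mem_iUnion₂.1 hyU
      refine ⟨z, hz, injOn_of_deriv_ne_zero (hFG x) (h1 z hz) ?_ ?_ ?_⟩
      · exact Set.Ioo_subset_Icc_self (hr z hz)
      · exact Set.Ioo_subset_Icc_self hyz
      · simp only [hr0 z hz, hy]
    · rintro ⟨z, hz, rfl⟩
      exact hr0 z hz
  · intro z hz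
    have := hr z hz
    refine lt_trans (abs_lt.2 ⟨?_, ?_⟩) hδε
    · linarith [this.1]
    · linarith [this.2]

/-- The `i`-th smallest element of a finite set of reals. -/
def nthElement (s : Finset ℝ) (i : ℕ) : ℝ :=
  if h : i < #s then s.orderEmbOfFin rfl ⟨i, h⟩ else 0

lemma nthElement_mem {s : Finset ℝ} {i : ℕ} (h : i < #s) : nthElement s i ∈ s := by
  rw [nthElement, dif_pos h]
  exact Finset.orderEmbOfFin_mem _ _ _

lemma nthElement_ne {s : Finset ℝ} {i j : ℕ} (hi : i < #s) (hj : j < #s) (hij : i ≠ j) :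
    nthElement s i ≠ nthElement s j := by
  rw [nthElement, nthElement, dif_pos hi, dif_pos hj]
  intro h
  have := (s.orderEmbOfFin rfl).injective h
  exact hij (Fin.mk.inj_iff.1 this)

lemma exists_nthElement_eq {s : Finset ℝ} {y : ℝ} (hy : y ∈ s) :
    ∃ i < #s, nthElement s i = y := by
  have : y ∈ Set.range (s.orderEmbOfFin rfl) := by rw [Finset.range_orderEmbOfFin]; exact hy
  obtain ⟨⟨i, hi⟩, rfl⟩ := this
  exact ⟨i, hi, by rw [nthElement, dif_pos hi]⟩

lemma nthElement_image {s : Finset ℝ} {r : ℝ → ℝ} (hr : StrictMonoOn r s) {i : ℕ} (hi : i < #s) :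
    nthElement (s.image r) i = r (nthElement s i) := by
  have hc : #(s.image r) = #s := Finset.card_image_of_injOn hr.injOn
  have hu := Finset.orderEmbOfFin_unique (s := s.image r) hc
    (f := fun j => r (s.orderEmbOfFin rfl j))
    (fun j => Finset.mem_image_of_mem _ (Finset.orderEmbOfFin_mem _ _ _))
    (fun a b hab => hr (Finset.orderEmbOfFin_mem _ _ _) (Finset.orderEmbOfFin_mem _ _ _)
      ((s.orderEmbOfFin rfl).strictMono hab))
  rw [nthElement, nthElement, dif_pos hi, dif_pos (hc.symm ▸ hi)]
  have := congrFun hu ⟨i, hi⟩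
  rw [this, Finset.orderEmbOfFin_eq_orderEmbOfFin_iff]

end LocalRoots

end

noncomputable section

open Finset Polynomial
open scoped Classical Polynomial.Bivariate

section Eliminant

lemma coeff_coeff_swap (p : ℝ[X][Y]) (m n : ℕ) :
    ((Bivariate.swap p).coeff m).coeff n = (p.coeff n).coeff m := by
  induction p using Polynomial.induction_on' with
  | add p q hp hq => simp [map_add, hp, hq]
  | monomial i a =>
    induction a using Polynomial.induction_on' with
    | add p q hp hq => simp only [map_add, coeff_add, hp, hq]
    | monomial j r =>
      rw [Bivariate.swap_monomial_monomial]
      simp only [coeff_monomial]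
      split_ifs <;> simp_all [coeff_monomial]

lemma natDegree_swap_le_iff {p : ℝ[X][Y]} {e : ℕ} :
    (Bivariate.swap p).natDegree ≤ e ↔ ∀ i, (p.coeff i).natDegree ≤ e := by
  constructor
  · intro h i
    rw [natDegree_le_iff_coeff_eq_zero]
    intro N hN
    rw [← coeff_coeff_swap, coeff_eq_zero_of_natDegree_lt (h.trans_lt hN), coeff_zero]
  · intro h
    rw [natDegree_le_iff_coeff_eq_zero]
    intro N hN
    ext i
    rw [coeff_coeff_swap, coeff_eq_zero_of_natDegree_lt ((h i).trans_lt hN), coeff_zero]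

lemma natDegree_det_le {n e : ℕ} (A : Matrix (Fin n) (Fin n) ℝ[X])
    (h : ∀ i j, (A i j).natDegree ≤ e) : A.det.natDegree ≤ n * e := by
  rw [Matrix.det_apply]
  refine natDegree_sum_le_of_forall_le _ _ fun σ _ => ?_
  refine (natDegree_smul_le _ _).trans ?_
  refine (natDegree_prod_le _ _).trans ?_
  exact (Finset.sum_le_card_nsmul _ _ e fun i _ => h _ _).trans (by simp)

lemma natDegree_resultant_le {f g : ℝ[X][Y]} {m n e : ℕ}
    (hf : ∀ i, (f.coeff i).natDegree ≤ e) (hg : ∀ i, (g.coeff i).natDegree ≤ e) :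
    (resultant f g m n).natDegree ≤ (m + n) * e := by
  refine natDegree_det_le _ fun i j => ?_
  unfold sylvester
  simp only [Matrix.of_apply]
  induction j using Fin.addCases with
  | left j => simp only [Fin.addCases_left]; split_ifs <;> simp [hg]
  | right j => simp only [Fin.addCases_right]; split_ifs <;> simp [hf]

lemma isPrimitive_of_irreducible {h : ℝ[X][Y]} (hi : Irreducible h) (hd : 0 < h.natDegree) :
    h.IsPrimitive := by
  intro r hr
  obtain ⟨q, rfl⟩ := hr
  rcases hi.isUnit_or_isUnit rfl with hu | hu
  · exact isUnit_C.1 hu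
  · exfalso
    have := natDegree_eq_zero_of_isUnit hu
    have h1 := natDegree_mul_le (p := C r) (q := q)
    rw [natDegree_C] at h1
    omega

/-- Eliminating `y` between an irreducible polynomial and a polynomial it does not divide. -/
lemma exists_eliminant {h g : ℝ[X][Y]} {e : ℕ} (hi : Irreducible h) (hd : 0 < h.natDegree)
    (hg : ¬ h ∣ g) (hhe : h.natDegree ≤ e) (hge : g.natDegree ≤ e)
    (hhx : ∀ i, (h.coeff i).natDegree ≤ e) (hgx : ∀ i, (g.coeff i).natDegree ≤ e) :
    ∃ r : ℝ[X], r ≠ 0 ∧ r.natDegree ≤ 2 * e * e ∧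
      ∀ x y, h.evalEval x y = 0 → g.evalEval x y = 0 → r.eval x = 0 := by
  refine ⟨resultant h g, ?_, ?_, ?_⟩
  · intro h0
    have hp := isPrimitive_of_irreducible hi hd
    have hinj := IsFractionRing.injective ℝ[X] (FractionRing ℝ[X])
    have hK := (hp.irreducible_iff_irreducible_map_fraction_map (K := FractionRing ℝ[X])).1 hi
    have hK' : ¬ h.map (algebraMap ℝ[X] (FractionRing ℝ[X])) ∣ g.map (algebraMap _ _) :=
      fun hdvd => hg (hp.dvd_of_fraction_map_dvd_fraction_map hdvd)
    have hres : resultant (h.map (algebraMap ℝ[X] (FractionRing ℝ[X])))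
        (g.map (algebraMap ℝ[X] (FractionRing ℝ[X]))) = 0 := by
      rw [natDegree_map_eq_of_injective hinj, natDegree_map_eq_of_injective hinj,
        resultant_map_map, h0, map_zero]
    rw [resultant_eq_zero_iff] at hres
    exact hres.2 ((EuclideanDomain.dvd_or_coprime _ _ hK).resolve_left hK')
  · refine (natDegree_resultant_le hhx hgx).trans ?_
    exact Nat.mul_le_mul_right _ (by omega)
  · intro x y h1 h2
    obtain ⟨p, q, -, -, hpq⟩ := exists_mul_add_mul_eq_C_resultant h g le_rfl le_rfl
      (Or.inl hd.ne')
    have := congrArg (evalEval x y) hpq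
    rw [evalEval_add, evalEval_mul, evalEval_mul, h1, h2, evalEval_C] at this
    simpa using this.symm

lemma exists_derivative_eliminant {h : ℝ[X][Y]} {e : ℕ} (hi : Irreducible h)
    (hd : 0 < h.natDegree) (hhe : h.natDegree ≤ e) (hhx : ∀ i, (h.coeff i).natDegree ≤ e) :
    ∃ r : ℝ[X], r ≠ 0 ∧ r.natDegree ≤ 2 * e * e ∧
      ∀ x y, h.evalEval x y = 0 → (derivative h).evalEval x y = 0 → r.eval x = 0 := by
  have hlt := natDegree_derivative_lt hd.ne'
  refine exists_eliminant hi hd ?_ hhe (by omega) hhx ?_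
  · intro hdvd
    have h0 : derivative h ≠ 0 := by
      intro h0
      exact hd.ne' (derivative_eq_zero.1 h0)
    have := natDegree_le_of_dvd hdvd h0
    omega
  · intro i
    rw [coeff_derivative]
    have : ((i : ℝ[X]) + 1) = C ((i : ℝ) + 1) := by simp
    rw [this]
    exact (natDegree_mul_C_le _ _).trans (hhx _)

end Eliminant

section RootsOverLine

/-- The restriction of a bivariate polynomial to a vertical line. -/
def fiber (h : ℝ[X][Y]) (x : ℝ) : ℝ[X] := h.map (evalRingHom x)

lemma eval_fiber (h : ℝ[X][Y]) (x y : ℝ) : (fiber h x).eval y = h.evalEval x y := by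
  rw [fiber, eval_map, eval₂_evalRingHom]

/-- The ordinates of the zeros of `h` on a vertical line. -/
def rootsAt (h : ℝ[X][Y]) (x : ℝ) : Finset ℝ := (fiber h x).roots.toFinset

lemma evalEval_eq_zero_of_mem_rootsAt {h : ℝ[X][Y]} {x y : ℝ} (hy : y ∈ rootsAt h x) :
    h.evalEval x y = 0 := by
  rw [rootsAt, Multiset.mem_toFinset] at hy
  rw [← eval_fiber]
  exact isRoot_of_mem_roots hy

lemma mem_rootsAt {h : ℝ[X][Y]} {x y : ℝ} (hx : fiber h x ≠ 0) :
    y ∈ rootsAt h x ↔ h.evalEval x y = 0 := by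
  rw [rootsAt, Multiset.mem_toFinset, mem_roots hx, IsRoot.def, eval_fiber]

lemma card_rootsAt_le (h : ℝ[X][Y]) (x : ℝ) : #(rootsAt h x) ≤ h.natDegree :=
  (Multiset.toFinset_card_le _).trans ((card_roots' _).trans natDegree_map_le)

/-- Over `x` the degree of `h` does not drop and `h` has only simple zeros. -/
def IsRegularAt (h : ℝ[X][Y]) (x : ℝ) : Prop :=
  h.leadingCoeff.eval x ≠ 0 ∧ ∀ y, h.evalEval x y = 0 → (derivative h).evalEval x y ≠ 0

lemma fiber_ne_zero {h : ℝ[X][Y]} {x : ℝ} (hx : h.leadingCoeff.eval x ≠ 0) : fiber h x ≠ 0 := by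
  intro h0
  have := congrArg (fun p => p.coeff h.natDegree) h0
  simp only [fiber, coeff_map, coe_evalRingHom, coeff_natDegree, coeff_zero] at this
  exact hx this

lemma exists_critical {h : ℝ[X][Y]} {e : ℕ} (hi : Irreducible h)
    (hd : 0 < h.natDegree) (hhe : h.natDegree ≤ e) (hhx : ∀ i, (h.coeff i).natDegree ≤ e) :
    ∃ c : Finset ℝ, #c ≤ 2 * e * e + e ∧ ∀ x ∉ c, IsRegularAt h x := by
  obtain ⟨r, hr0, hrd, hr⟩ := exists_derivative_eliminant hi hd hhe hhx
  have hl : h.leadingCoeff ≠ 0 := leadingCoeff_ne_zero.2 hi.ne_zero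
  refine ⟨r.roots.toFinset ∪ h.leadingCoeff.roots.toFinset, ?_, ?_⟩
  · refine (Finset.card_union_le _ _).trans (add_le_add ?_ ?_)
    · exact (Multiset.toFinset_card_le _).trans ((card_roots' _).trans hrd)
    · exact (Multiset.toFinset_card_le _).trans ((card_roots' _).trans (hhx _))
  · intro x hx
    simp only [Finset.mem_union, Multiset.mem_toFinset, mem_roots hr0, mem_roots hl, IsRoot.def,
      not_or] at hx
    exact ⟨hx.2, fun y h1 h2 => hx.1 (hr x y h1 h2)⟩

lemma continuous_evalEval (h : ℝ[X][Y]) : Continuous fun p : ℝ × ℝ => h.evalEval p.1 p.2 := by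
  induction h using Polynomial.induction_on' with
  | add p q hp hq =>
    simp only [evalEval_add]
    exact hp.add hq
  | monomial i a =>
    have : (fun p : ℝ × ℝ => (monomial i a : ℝ[X][Y]).evalEval p.1 p.2) =
        fun p => a.eval p.1 * p.2 ^ i := by
      funext p
      rw [← C_mul_X_pow_eq_monomial, evalEval_mul, evalEval_C, evalEval_pow, evalEval_X]
    rw [this]
    exact (a.continuous.comp continuous_fst).mul (continuous_snd.pow _)

lemma hasDerivAt_evalEval (h : ℝ[X][Y]) (x y : ℝ) :
    HasDerivAt (fun y => h.evalEval x y) ((derivative h).evalEval x y) y := by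
  have := (fiber h x).hasDerivAt y
  simp only [eval_fiber] at this
  rwa [fiber, derivative_map, ← fiber, eval_fiber] at this

lemma eventually_roots_bounded {h : ℝ[X][Y]} {x₀ : ℝ} (hx : h.leadingCoeff.eval x₀ ≠ 0) :
    ∃ B : ℝ, ∀ᶠ x in nhds x₀, ∀ y, h.evalEval x y = 0 → y ∈ Set.Icc (-B) B := by
  let φ : ℝ → NNReal := fun x =>
    (Finset.range h.natDegree).sup (fun i => ‖(h.coeff i).eval x‖₊) / ‖h.leadingCoeff.eval x‖₊ + 1
  have hφ : ContinuousAt φ x₀ := by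
    refine ContinuousAt.add (ContinuousAt.div ?_ ?_ (by simpa using hx)) continuousAt_const
    · exact ContinuousAt.finset_sup_apply fun i _ => (h.coeff i).continuous.nnnorm.continuousAt
    · exact h.leadingCoeff.continuous.nnnorm.continuousAt
  refine ⟨φ x₀ + 1, ?_⟩
  have h1 : ∀ᶠ x in nhds x₀, φ x < φ x₀ + 1 := hφ.eventually_lt continuousAt_const (by simp)
  have h2 : ∀ᶠ x in nhds x₀, h.leadingCoeff.eval x ≠ 0 :=
    h.leadingCoeff.continuous.continuousAt.eventually_ne hx
  filter_upwards [h1, h2] with x h1 h2 y hy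
  have hroot : (fiber h x).IsRoot y := by rw [IsRoot.def, eval_fiber, hy]
  have hb := hroot.norm_lt_cauchyBound (fiber_ne_zero h2)
  have hdeg : (fiber h x).natDegree = h.natDegree :=
    natDegree_map_of_leadingCoeff_ne_zero _ h2
  have hlead : (fiber h x).leadingCoeff = h.leadingCoeff.eval x := by
    rw [leadingCoeff, hdeg, fiber, coeff_map]; rfl
  have hc : cauchyBound (fiber h x) = φ x := by
    rw [cauchyBound, hdeg, hlead]
    simp only [fiber, coeff_map, φ, coe_evalRingHom]
  rw [hc] at hb
  have hb' : |y| < (φ x : ℝ) := by exact_mod_cast hb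
  have h1' : (φ x : ℝ) < φ x₀ + 1 := by exact_mod_cast h1
  exact abs_le.1 (hb'.trans h1').le

lemma IsRegularAt.eventually_rootsAt {h : ℝ[X][Y]} {x₀ : ℝ} (hreg : IsRegularAt h x₀) {ε : ℝ}
    (hε : 0 < ε) :
    ∀ᶠ x in nhds x₀, ∃ r : ℝ → ℝ, StrictMonoOn r (rootsAt h x₀) ∧
      (rootsAt h x₀).image r = rootsAt h x ∧ ∀ z ∈ rootsAt h x₀, |r z - z| < ε := by
  obtain ⟨B, hB⟩ := eventually_roots_bounded hreg.1
  have hZ : ∀ y, h.evalEval x₀ y = 0 ↔ y ∈ rootsAt h x₀ := fun y =>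
    (mem_rootsAt (fiber_ne_zero hreg.1)).symm
  have := eventually_exists_root_bijection (continuous_evalEval h)
    (continuous_evalEval (derivative h)) (hasDerivAt_evalEval h) hZ
    (fun z hz => hreg.2 z ((hZ z).2 hz)) hB hε
  have h2 : ∀ᶠ x in nhds x₀, h.leadingCoeff.eval x ≠ 0 :=
    h.leadingCoeff.continuous.continuousAt.eventually_ne hreg.1
  filter_upwards [this, h2] with x ⟨r, hr, hr', hr''⟩ h2
  refine ⟨r, hr, ?_, hr''⟩
  ext y
  rw [Finset.mem_image, mem_rootsAt (fiber_ne_zero h2)]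
  exact (hr' y).symm

lemma IsRegularAt.eventually_card_rootsAt {h : ℝ[X][Y]} {x₀ : ℝ} (hreg : IsRegularAt h x₀) :
    ∀ᶠ x in nhds x₀, #(rootsAt h x) = #(rootsAt h x₀) := by
  filter_upwards [hreg.eventually_rootsAt one_pos] with x ⟨r, hr, hr', _⟩
  rw [← hr', Finset.card_image_of_injOn hr.injOn]

lemma IsRegularAt.continuousAt_nthElement {h : ℝ[X][Y]} {x₀ : ℝ} (hreg : IsRegularAt h x₀)
    (i : ℕ) : ContinuousAt (fun x => nthElement (rootsAt h x) i) x₀ := by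
  by_cases hi : i < #(rootsAt h x₀)
  · rw [ContinuousAt, Metric.tendsto_nhds]
    intro ε hε
    filter_upwards [hreg.eventually_rootsAt hε] with x ⟨r, hr, hr', hr''⟩
    rw [← hr', nthElement_image hr hi, Real.dist_eq]
    exact hr'' _ (nthElement_mem hi)
  · refine (continuousAt_const (y := (0 : ℝ))).congr ?_
    filter_upwards [hreg.eventually_card_rootsAt] with x hx
    rw [nthElement, dif_neg (by rwa [hx])]

lemma card_rootsAt_eq {h : ℝ[X][Y]} {u v x y : ℝ} (hreg : ∀ x ∈ Set.Icc u v, IsRegularAt h x)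
    (hx : x ∈ Set.Icc u v) (hy : y ∈ Set.Icc u v) : #(rootsAt h x) = #(rootsAt h y) := by
  have hloc : IsLocallyConstant fun x : Set.Icc u v => #(rootsAt h x) := by
    rw [IsLocallyConstant.iff_eventually_eq]
    intro x
    exact (continuous_subtype_val.tendsto x).eventually (hreg x x.2).eventually_card_rootsAt
  have : PreconnectedSpace (Set.Icc u v) :=
    isPreconnected_iff_preconnectedSpace.1 isPreconnected_Icc
  exact hloc.apply_eq_of_preconnectedSpace ⟨x, hx⟩ ⟨y, hy⟩

end RootsOverLine

section Factors

/-- The normalized irreducible factors of `f` which involve the second variable. -/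
def yFactors (f : ℝ[X][Y]) : Finset ℝ[X][Y] :=
  (UniqueFactorizationMonoid.normalizedFactors f).toFinset.filter fun h => 0 < h.natDegree

lemma mem_normalizedFactors_of_mem_yFactors {f h : ℝ[X][Y]} (hh : h ∈ yFactors f) :
    h ∈ UniqueFactorizationMonoid.normalizedFactors f :=
  Multiset.mem_toFinset.1 (Finset.mem_filter.1 hh).1

lemma irreducible_of_mem_yFactors {f h : ℝ[X][Y]} (hh : h ∈ yFactors f) : Irreducible h :=
  UniqueFactorizationMonoid.irreducible_of_normalized_factor _
    (mem_normalizedFactors_of_mem_yFactors hh)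

lemma natDegree_pos_of_mem_yFactors {f h : ℝ[X][Y]} (hh : h ∈ yFactors f) : 0 < h.natDegree :=
  (Finset.mem_filter.1 hh).2

lemma dvd_of_mem_yFactors {f h : ℝ[X][Y]} (hh : h ∈ yFactors f) : h ∣ f :=
  UniqueFactorizationMonoid.dvd_of_mem_normalizedFactors (mem_normalizedFactors_of_mem_yFactors hh)

lemma not_dvd_of_mem_yFactors {f f' h h' : ℝ[X][Y]} (hh : h ∈ yFactors f) (hh' : h' ∈ yFactors f')
    (hne : h ≠ h') : ¬ h ∣ h' := by
  intro hdvd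
  have ha := (irreducible_of_mem_yFactors hh).associated_of_dvd (irreducible_of_mem_yFactors hh')
    hdvd
  apply hne
  rw [← UniqueFactorizationMonoid.normalize_normalized_factor h
      (mem_normalizedFactors_of_mem_yFactors hh),
    ← UniqueFactorizationMonoid.normalize_normalized_factor h'
      (mem_normalizedFactors_of_mem_yFactors hh')]
  exact normalize_eq_normalize_iff_associated.2 ha

lemma natDegree_le_of_mem_yFactors {f h : ℝ[X][Y]} (hf : f ≠ 0) (hh : h ∈ yFactors f) :
    h.natDegree ≤ f.natDegree :=
  natDegree_le_of_dvd (dvd_of_mem_yFactors hh) hf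

lemma natDegree_coeff_le_of_mem_yFactors {f h : ℝ[X][Y]} {e : ℕ} (hf : f ≠ 0)
    (hfe : ∀ i, (f.coeff i).natDegree ≤ e) (hh : h ∈ yFactors f) (i : ℕ) :
    (h.coeff i).natDegree ≤ e := by
  obtain ⟨g, rfl⟩ := dvd_of_mem_yFactors hh
  have hg : (Bivariate.swap h * Bivariate.swap g).natDegree ≤ e := by
    rw [← map_mul]
    exact natDegree_swap_le_iff.2 hfe
  have hne : Bivariate.swap h * Bivariate.swap g ≠ 0 := by
    rw [← map_mul]
    exact (map_ne_zero_iff _ (AlgEquiv.injective _)).2 hf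
  exact natDegree_swap_le_iff.1 ((natDegree_le_of_dvd (Dvd.intro _ rfl) hne).trans hg) i

lemma card_yFactors_le {f : ℝ[X][Y]} (hf : f ≠ 0) : #(yFactors f) ≤ f.natDegree := by
  set S := UniqueFactorizationMonoid.normalizedFactors f with hS
  have h0 : (0 : ℝ[X][Y]) ∉ S := fun h => UniqueFactorizationMonoid.zero_notMem_normalizedFactors f h
  have hdeg : (S.map natDegree).sum = f.natDegree := by
    rw [← natDegree_multiset_prod S h0]
    exact natDegree_eq_of_degree_eq
      (degree_eq_degree_of_associated (UniqueFactorizationMonoid.prod_normalizedFactors hf))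
  calc #(yFactors f) = ∑ h ∈ yFactors f, 1 := by simp
    _ ≤ ∑ h ∈ yFactors f, h.natDegree :=
        Finset.sum_le_sum fun h hh => natDegree_pos_of_mem_yFactors hh
    _ ≤ ∑ h ∈ S.toFinset, h.natDegree := Finset.sum_le_sum_of_subset (Finset.filter_subset _ _)
    _ ≤ ∑ h ∈ S.toFinset, S.count h • h.natDegree := by
        refine Finset.sum_le_sum fun h hh => ?_
        have : 1 ≤ S.count h := Multiset.one_le_count_iff_mem.2 (Multiset.mem_toFinset.1 hh)
        simpa using Nat.mul_le_mul_right h.natDegree this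
    _ = f.natDegree := by rw [← Finset.sum_multiset_map_count, hdeg]

lemma evalEval_eq_zero_of_dvd {f h : ℝ[X][Y]} {x y : ℝ} (hdvd : h ∣ f) (hh : h.evalEval x y = 0) :
    f.evalEval x y = 0 := by
  obtain ⟨g, rfl⟩ := hdvd
  rw [evalEval_mul, hh, zero_mul]

lemma exists_mem_yFactors_or_vertical {f : ℝ[X][Y]} (hf : f ≠ 0) {x y : ℝ}
    (hxy : f.evalEval x y = 0) :
    (∃ h ∈ yFactors f, h.evalEval x y = 0) ∨ ∀ y', f.evalEval x y' = 0 := by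
  have hdvd := (UniqueFactorizationMonoid.prod_normalizedFactors hf).symm.dvd
  have hprod := evalEval_eq_zero_of_dvd hdvd hxy
  rw [← coe_evalEvalRingHom, map_multiset_prod, Multiset.prod_eq_zero_iff, Multiset.mem_map]
    at hprod
  obtain ⟨h, hh, hz⟩ := hprod
  rw [coe_evalEvalRingHom] at hz
  by_cases hd : 0 < h.natDegree
  · exact Or.inl ⟨h, Finset.mem_filter.2 ⟨Multiset.mem_toFinset.2 hh, hd⟩, hz⟩
  · refine Or.inr fun y' => evalEval_eq_zero_of_dvd
      (UniqueFactorizationMonoid.dvd_of_mem_normalizedFactors hh) ?_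
    rw [eq_C_of_natDegree_eq_zero (Nat.eq_zero_of_not_pos hd), evalEval_C] at hz ⊢
    exact hz

end Factors

section Slabs

/-- The number of elements of `c` to the left of `x`. -/
def slabIndex (c : Finset ℝ) (x : ℝ) : ℕ := #{t ∈ c | t < x}

lemma slabIndex_le (c : Finset ℝ) (x : ℝ) : slabIndex c x ≤ #c := Finset.card_filter_le _ _

lemma slabIndex_mono (c : Finset ℝ) : Monotone (slabIndex c) := fun _ _ hxy =>
  Finset.card_le_card (Finset.monotone_filter_right _ fun _ _ ht => lt_of_lt_of_le ht hxy)

lemma slabIndex_lt {c : Finset ℝ} {t x : ℝ} (ht : t ∈ c) (htx : t < x) :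
    slabIndex c t < slabIndex c x := by
  refine Finset.card_lt_card ⟨Finset.monotone_filter_right _ fun _ _ h => h.trans htx, fun h => ?_⟩
  have := h (Finset.mem_filter.2 ⟨ht, htx⟩)
  exact lt_irrefl _ (Finset.mem_filter.1 this).2

/-- The elements of `X` outside `c` with exactly `j` elements of `c` on their left. -/
def slab (c X : Finset ℝ) (j : ℕ) : Finset ℝ := {x ∈ X | x ∉ c ∧ slabIndex c x = j}

/-- The left end of the convex hull of a slab. -/
def slabLo (c X : Finset ℝ) (j : ℕ) : ℝ :=
  if h : (slab c X j).Nonempty then (slab c X j).min' h else 1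

/-- The right end of the convex hull of a slab. -/
def slabHi (c X : Finset ℝ) (j : ℕ) : ℝ :=
  if h : (slab c X j).Nonempty then (slab c X j).max' h else 0

lemma mem_Icc_slab {c X : Finset ℝ} {x : ℝ} (hx : x ∈ X) (hxc : x ∉ c) :
    x ∈ Set.Icc (slabLo c X (slabIndex c x)) (slabHi c X (slabIndex c x)) := by
  have hm : x ∈ slab c X (slabIndex c x) := Finset.mem_filter.2 ⟨hx, hxc, rfl⟩
  have hne : (slab c X (slabIndex c x)).Nonempty := ⟨x, hm⟩
  rw [slabLo, slabHi, dif_pos hne, dif_pos hne]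
  exact ⟨Finset.min'_le _ _ hm, Finset.le_max' _ _ hm⟩

lemma notMem_and_slabIndex_eq {c X : Finset ℝ} {j : ℕ} {t : ℝ}
    (ht : t ∈ Set.Icc (slabLo c X j) (slabHi c X j)) : t ∉ c ∧ slabIndex c t = j := by
  by_cases hne : (slab c X j).Nonempty
  · rw [slabLo, slabHi, dif_pos hne, dif_pos hne] at ht
    obtain ⟨-, -, h1⟩ := Finset.mem_filter.1 ((slab c X j).min'_mem hne)
    obtain ⟨-, h2, h3⟩ := Finset.mem_filter.1 ((slab c X j).max'_mem hne)
    have hl := slabIndex_mono c ht.1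
    have hr := slabIndex_mono c ht.2
    refine ⟨fun htc => ?_, by omega⟩
    have hlt : t < (slab c X j).max' hne := lt_of_le_of_ne ht.2 fun h => h2 (h ▸ htc)
    have := slabIndex_lt htc hlt
    omega
  · rw [slabLo, slabHi, dif_neg hne, dif_neg hne] at ht
    exact absurd (ht.1.trans ht.2) (by norm_num)

end Slabs

section RootArcs

/-- The abscissae over which `h` is not regular (empty if there are infinitely many). -/
def critical (h : ℝ[X][Y]) : Finset ℝ :=
  if H : {x | ¬ IsRegularAt h x}.Finite then H.toFinset else ∅

lemma critical_spec {h : ℝ[X][Y]} {e : ℕ} (hi : Irreducible h)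
    (hd : 0 < h.natDegree) (hhe : h.natDegree ≤ e) (hhx : ∀ i, (h.coeff i).natDegree ≤ e) :
    #(critical h) ≤ 2 * e * e + e ∧ ∀ x ∉ critical h, IsRegularAt h x := by
  obtain ⟨c, hc, hreg⟩ := exists_critical hi hd hhe hhx
  have hsub : {x | ¬ IsRegularAt h x} ⊆ c := fun x hx => by
    by_contra hxc
    exact hx (hreg x hxc)
  have hfin : {x | ¬ IsRegularAt h x}.Finite := c.finite_toSet.subset hsub
  rw [critical, dif_pos hfin]
  refine ⟨(Finset.card_le_card fun x hx => hsub (hfin.mem_toFinset.1 hx)).trans hc, fun x hx => ?_⟩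
  rw [hfin.mem_toFinset] at hx
  exact not_not.1 hx

/-- The label of an arc: the curve carrying it, the factor of its equation, the position among the
zeros of that factor on vertical lines, and the ends of its domain. -/
@[ext]
structure ArcLabel (κ : Type*) where
  /-- The curve carrying the arc. -/
  curve : κ
  /-- The polynomial vanishing on the arc. -/
  poly : ℝ[X][Y]
  /-- The position of the arc among the zeros of the polynomial, from the bottom. -/
  idx : ℕ
  /-- The left end of the domain. -/
  lo : ℝ
  /-- The right end of the domain. -/
  hi : ℝ

variable {κ : Type*}

/-- The label describes a continuous branch of zeros. -/
def ArcLabel.IsBranch (a : ArcLabel κ) : Prop :=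
  ContinuousOn (fun x => nthElement (rootsAt a.poly x) a.idx) (Set.Icc a.lo a.hi) ∧
    ∀ x ∈ Set.Icc a.lo a.hi, a.idx < #(rootsAt a.poly x)

/-- Branches of zeros of bivariate polynomials; labels which describe no branch get an empty
domain. -/
def branches (κ : Type*) : ArcFamily (ArcLabel κ) where
  left a := if a.IsBranch then a.lo else 1
  right a := if a.IsBranch then a.hi else 0
  fn a x := nthElement (rootsAt a.poly x) a.idx
  continuousOn a := by
    by_cases ha : a.IsBranch
    · rw [if_pos ha, if_pos ha]
      exact ha.1
    · rw [if_neg ha, if_neg ha, Set.Icc_eq_empty (by norm_num)]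
      exact continuousOn_empty _

lemma mem_dom_branches {a : ArcLabel κ} {x : ℝ} :
    x ∈ (branches κ).dom a ↔ a.IsBranch ∧ x ∈ Set.Icc a.lo a.hi := by
  simp only [ArcFamily.dom, branches]
  by_cases ha : a.IsBranch
  · simp only [ha, if_true, true_and]
  · simp only [ha, if_false, false_and, iff_false]
    exact fun h => absurd (h.1.trans h.2) (by norm_num)

lemma evalEval_fn_branches {a : ArcLabel κ} {x : ℝ} (hx : x ∈ (branches κ).dom a) :
    a.poly.evalEval x ((branches κ).fn a x) = 0 := by
  rw [mem_dom_branches] at hx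
  exact evalEval_eq_zero_of_mem_rootsAt (nthElement_mem (hx.1.2 x hx.2))

lemma evalEval_eq_zero_of_on {a : ArcLabel κ} {p : ℝ × ℝ} (hp : (branches κ).On p a) :
    a.poly.evalEval p.1 p.2 = 0 := by
  rw [← hp.2]
  exact evalEval_fn_branches hp.1

/-- The arcs into which the zero set of `h` is cut, over the abscissae in `X`. -/
def factorArcs (X : Finset ℝ) (γ : κ) (h : ℝ[X][Y]) : Finset (ArcLabel κ) :=
  (range (#(critical h) + 1) ×ˢ range h.natDegree).image fun ji =>
    ⟨γ, h, ji.2, slabLo (critical h) X ji.1, slabHi (critical h) X ji.1⟩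

/-- The arcs into which the zero set of `f` is cut, over the abscissae in `X`. -/
def curveArcs (X : Finset ℝ) (γ : κ) (f : ℝ[X][Y]) : Finset (ArcLabel κ) :=
  (yFactors f).biUnion fun h => factorArcs X γ h

lemma mem_curveArcs {X : Finset ℝ} {γ : κ} {f : ℝ[X][Y]} {a : ArcLabel κ}
    (ha : a ∈ curveArcs X γ f) : a.curve = γ ∧ a.poly ∈ yFactors f ∧
      ∃ j, a.lo = slabLo (critical a.poly) X j ∧ a.hi = slabHi (critical a.poly) X j := by
  obtain ⟨h, hh, ha⟩ := Finset.mem_biUnion.1 ha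
  obtain ⟨ji, -, rfl⟩ := Finset.mem_image.1 ha
  exact ⟨rfl, hh, ji.1, rfl, rfl⟩

variable {f : ℝ[X][Y]} {e : ℕ}

lemma critical_spec_of_mem_yFactors (hf : f ≠ 0) (hfe : f.natDegree ≤ e)
    (hfx : ∀ i, (f.coeff i).natDegree ≤ e) {h : ℝ[X][Y]} (hh : h ∈ yFactors f) :
    #(critical h) ≤ 2 * e * e + e ∧ ∀ x ∉ critical h, IsRegularAt h x :=
  critical_spec (irreducible_of_mem_yFactors hh) (natDegree_pos_of_mem_yFactors hh)
    ((natDegree_le_of_mem_yFactors hf hh).trans hfe)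
    (natDegree_coeff_le_of_mem_yFactors hf hfx hh)

lemma card_curveArcs_le (hf : f ≠ 0) (hfe : f.natDegree ≤ e)
    (hfx : ∀ i, (f.coeff i).natDegree ≤ e) (X : Finset ℝ) (γ : κ) :
    #(curveArcs X γ f) ≤ e * ((2 * e * e + e + 1) * e) := by
  refine (Finset.card_biUnion_le_card_mul _ _ ((2 * e * e + e + 1) * e) fun h hh => ?_).trans
    (Nat.mul_le_mul_right _ ((card_yFactors_le hf).trans hfe))
  refine Finset.card_image_le.trans ?_
  rw [Finset.card_product, Finset.card_range, Finset.card_range]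
  exact Nat.mul_le_mul
    (Nat.add_le_add_right (critical_spec_of_mem_yFactors hf hfe hfx hh).1 1)
    ((natDegree_le_of_mem_yFactors hf hh).trans hfe)

lemma exists_mem_curveArcs_on (hf : f ≠ 0) (hfe : f.natDegree ≤ e)
    (hfx : ∀ i, (f.coeff i).natDegree ≤ e) {X : Finset ℝ} (γ : κ) {h : ℝ[X][Y]}
    (hh : h ∈ yFactors f) {p : ℝ × ℝ} (hpX : p.1 ∈ X) (hp : h.evalEval p.1 p.2 = 0)
    (hpc : p.1 ∉ critical h) : ∃ a ∈ curveArcs X γ f, (branches κ).On p a := by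
  have hcrit := (critical_spec_of_mem_yFactors hf hfe hfx hh).2
  have hmem : p.2 ∈ rootsAt h p.1 := (mem_rootsAt (fiber_ne_zero (hcrit _ hpc).1)).2 hp
  obtain ⟨i, hi, hip⟩ := exists_nthElement_eq hmem
  set j := slabIndex (critical h) p.1 with hj
  have hreg : ∀ x ∈ Set.Icc (slabLo (critical h) X j) (slabHi (critical h) X j),
      IsRegularAt h x := fun x hx => hcrit x (notMem_and_slabIndex_eq hx).1
  have hpI : p.1 ∈ Set.Icc (slabLo (critical h) X j) (slabHi (critical h) X j) :=
    mem_Icc_slab hpX hpc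
  refine ⟨⟨γ, h, i, slabLo (critical h) X j, slabHi (critical h) X j⟩, ?_, ?_, hip⟩
  · refine Finset.mem_biUnion.2 ⟨h, hh, Finset.mem_image.2 ⟨(j, i), ?_, rfl⟩⟩
    rw [Finset.mem_product, Finset.mem_range, Finset.mem_range]
    exact ⟨Nat.lt_succ_of_le (slabIndex_le _ _), hi.trans_le (card_rootsAt_le _ _)⟩
  · refine mem_dom_branches.2 ⟨⟨fun x hx => ?_, fun x hx => ?_⟩, hpI⟩
    · exact ((hreg x hx).continuousAt_nthElement i).continuousWithinAt
    · exact hi.trans_le (card_rootsAt_eq hreg hpI hx).le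

/-- The points of the zero set of `f` which may lie on none of its arcs. -/
lemma card_exceptional_le (hf : f ≠ 0) (hfe : f.natDegree ≤ e)
    (hfx : ∀ i, (f.coeff i).natDegree ≤ e) (V : Finset (ℝ × ℝ)) :
    #{p ∈ V | ∃ h ∈ yFactors f, h.evalEval p.1 p.2 = 0 ∧ p.1 ∈ critical h ∧ fiber h p.1 ≠ 0} ≤
      e * ((2 * e * e + e) * e) := by
  have hsub : {p ∈ V | ∃ h ∈ yFactors f, h.evalEval p.1 p.2 = 0 ∧ p.1 ∈ critical h ∧
      fiber h p.1 ≠ 0} ⊆ (yFactors f).biUnion fun h => (critical h).biUnion fun x =>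
        (rootsAt h x).image fun y => (x, y) := by
    intro p hp
    obtain ⟨-, h, hh, h0, hc, hne⟩ := Finset.mem_filter.1 hp
    exact Finset.mem_biUnion.2 ⟨h, hh, Finset.mem_biUnion.2 ⟨p.1, hc, Finset.mem_image.2
      ⟨p.2, (mem_rootsAt hne).2 h0, rfl⟩⟩⟩
  refine (Finset.card_le_card hsub).trans ?_
  refine (Finset.card_biUnion_le_card_mul _ _ ((2 * e * e + e) * e) fun h hh => ?_).trans
    (Nat.mul_le_mul_right _ ((card_yFactors_le hf).trans hfe))
  refine (Finset.card_biUnion_le_card_mul _ _ e fun x _ => ?_).trans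
    (Nat.mul_le_mul_right _ (critical_spec_of_mem_yFactors hf hfe hfx hh).1)
  exact Finset.card_image_le.trans ((card_rootsAt_le h x).trans
    ((natDegree_le_of_mem_yFactors hf hh).trans hfe))

lemma vertical_or_exceptional_or_on (hf : f ≠ 0) (hfe : f.natDegree ≤ e)
    (hfx : ∀ i, (f.coeff i).natDegree ≤ e) {X : Finset ℝ} (γ : κ) {p : ℝ × ℝ} (hpX : p.1 ∈ X)
    (hp : f.evalEval p.1 p.2 = 0) :
    (∀ y, f.evalEval p.1 y = 0) ∨
    (∃ h ∈ yFactors f, h.evalEval p.1 p.2 = 0 ∧ p.1 ∈ critical h ∧ fiber h p.1 ≠ 0) ∨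
      ∃ a ∈ curveArcs X γ f, (branches κ).On p a := by
  rcases exists_mem_yFactors_or_vertical hf hp with ⟨h, hh, h0⟩ | hv
  · by_cases hc : p.1 ∈ critical h
    · by_cases hfib : fiber h p.1 = 0
      · refine Or.inl fun y => evalEval_eq_zero_of_dvd (dvd_of_mem_yFactors hh) ?_
        rw [← eval_fiber, hfib, eval_zero]
      · exact Or.inr (Or.inl ⟨h, hh, h0, hc, hfib⟩)
    · exact Or.inr (Or.inr (exists_mem_curveArcs_on hf hfe hfx γ hh hpX h0 hc))
  · exact Or.inl hv

end RootArcs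

section CurveSystem

variable {κ : Type*} {F : κ → ℝ[X][Y]} {e : ℕ} {Γ : Finset κ}

lemma meet_branches (hF : ∀ γ ∈ Γ, F γ ≠ 0) (hFe : ∀ γ ∈ Γ, (F γ).natDegree ≤ e)
    (hFx : ∀ γ ∈ Γ, ∀ i, ((F γ).coeff i).natDegree ≤ e)
    (hfin : ∀ γ ∈ Γ, ∀ γ' ∈ Γ, γ ≠ γ' →
      {p : ℝ × ℝ | (F γ).evalEval p.1 p.2 = 0 ∧ (F γ').evalEval p.1 p.2 = 0}.Finite)
    {X : Finset ℝ} {γ γ' : κ} (hγ : γ ∈ Γ) (hγ' : γ' ∈ Γ) {a b : ArcLabel κ}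
    (ha : a ∈ curveArcs X γ (F γ)) (hb : b ∈ curveArcs X γ' (F γ')) (hab : a ≠ b) :
    ((branches κ).meet a b).Finite ∧ ((branches κ).meet a b).ncard ≤ 2 * e * e + 1 := by
  obtain ⟨hac, hap, j, hal, har⟩ := mem_curveArcs ha
  obtain ⟨hbc, hbp, j', hbl, hbr⟩ := mem_curveArcs hb
  by_cases hpoly : a.poly = b.poly
  · suffices h : ((branches κ).meet a b).Subsingleton from
      ⟨h.finite, ((Set.ncard_le_one h.finite).2 fun x hx y hy => h hx hy).trans
        (Nat.le_add_left _ _)⟩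
    rcases Set.eq_empty_or_nonempty ((branches κ).meet a b) with h0 | ⟨x, hxa, hxb, hx⟩
    · rw [h0]
      exact Set.subsingleton_empty
    rw [mem_dom_branches] at hxa hxb
    have hj : j = j' := by
      have h1 := hxa.2
      have h2 := hxb.2
      rw [hal, har] at h1
      rw [hbl, hbr, ← hpoly] at h2
      rw [← (notMem_and_slabIndex_eq h1).2, (notMem_and_slabIndex_eq h2).2]
    have hlo : a.lo = b.lo := by rw [hal, hbl, hj, hpoly]
    have hhi : a.hi = b.hi := by rw [har, hbr, hj, hpoly]
    have hidx : a.idx = b.idx := by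
      by_contra hne
      have h1 := hxa.1.2 x hxa.2
      have h2 := hxb.1.2 x hxb.2
      rw [← hpoly] at h2
      refine nthElement_ne h1 h2 hne ?_
      simp only [branches, ← hpoly] at hx
      exact hx
    have hcurve : γ ≠ γ' := by
      rintro rfl
      exact hab (ArcLabel.ext (hac.trans hbc.symm) hpoly hidx hlo hhi)
    have hmaps : Set.MapsTo (fun t => (t, (branches κ).fn a t)) (Set.Icc a.lo a.hi)
        {p : ℝ × ℝ | (F γ).evalEval p.1 p.2 = 0 ∧ (F γ').evalEval p.1 p.2 = 0} := by
      intro t ht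
      have h0 := evalEval_fn_branches (mem_dom_branches.2 ⟨hxa.1, ht⟩)
      exact ⟨evalEval_eq_zero_of_dvd (dvd_of_mem_yFactors hap) h0,
        evalEval_eq_zero_of_dvd (hpoly ▸ dvd_of_mem_yFactors hbp) h0⟩
    have hIcc : (Set.Icc a.lo a.hi).Finite :=
      Set.Finite.of_finite_image ((hfin γ hγ γ' hγ' hcurve).subset hmaps.image_subset)
        fun s _ t _ hst => congrArg Prod.fst hst
    have hle : a.hi ≤ a.lo := by
      by_contra! hlt
      exact Set.Icc_infinite hlt hIcc
    refine (Set.subsingleton_Icc_of_ge hle).anti fun t ht => ?_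
    exact (mem_dom_branches.1 ht.1).2
  · have hd := (natDegree_le_of_mem_yFactors (hF γ hγ) hap).trans (hFe γ hγ)
    have hd' := (natDegree_le_of_mem_yFactors (hF γ' hγ') hbp).trans (hFe γ' hγ')
    obtain ⟨r, hr0, hrd, hr⟩ := exists_eliminant (irreducible_of_mem_yFactors hap)
      (natDegree_pos_of_mem_yFactors hap) (not_dvd_of_mem_yFactors hap hbp hpoly) hd hd'
      (natDegree_coeff_le_of_mem_yFactors (hF γ hγ) (hFx γ hγ) hap)
      (natDegree_coeff_le_of_mem_yFactors (hF γ' hγ') (hFx γ' hγ') hbp)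
    have hsub : (branches κ).meet a b ⊆ r.roots.toFinset := by
      rintro x ⟨hxa, hxb, hx⟩
      rw [Finset.mem_coe, Multiset.mem_toFinset, mem_roots hr0]
      refine hr x _ (evalEval_fn_branches hxa) ?_
      rw [hx]
      exact evalEval_fn_branches hxb
    refine ⟨r.roots.toFinset.finite_toSet.subset hsub, ?_⟩
    refine (Set.ncard_le_ncard hsub r.roots.toFinset.finite_toSet).trans ?_
    rw [Set.ncard_coe_finset]
    exact ((Multiset.toFinset_card_le _).trans ((card_roots' _).trans hrd)).trans
      (Nat.le_add_right _ _)

lemma sum_card_vertical_le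
    (hfin : ∀ γ ∈ Γ, ∀ γ' ∈ Γ, γ ≠ γ' →
      {p : ℝ × ℝ | (F γ).evalEval p.1 p.2 = 0 ∧ (F γ').evalEval p.1 p.2 = 0}.Finite)
    (V : Finset (ℝ × ℝ)) :
    ∑ γ ∈ Γ, #{p ∈ V | ∀ y, (F γ).evalEval p.1 y = 0} ≤ #V := by
  have hswap : ∑ γ ∈ Γ, #{p ∈ V | ∀ y, (F γ).evalEval p.1 y = 0} =
      ∑ p ∈ V, #{γ ∈ Γ | ∀ y, (F γ).evalEval p.1 y = 0} :=
    Finset.sum_card_bipartiteAbove_eq_sum_card_bipartiteBelow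
      (fun γ (p : ℝ × ℝ) => ∀ y, (F γ).evalEval p.1 y = 0)
  rw [hswap, Finset.card_eq_sum_ones]
  refine Finset.sum_le_sum fun p _ => Finset.card_le_one.2 fun γ hγ γ' hγ' => ?_
  rw [Finset.mem_filter] at hγ hγ'
  by_contra hne
  have hinj : Function.Injective fun y : ℝ => (p.1, y) := fun y z h => congrArg Prod.snd h
  refine Set.infinite_range_of_injective hinj ((hfin γ hγ.1 γ' hγ'.1 hne).subset ?_)
  rintro _ ⟨y, rfl⟩
  exact ⟨hγ.2 y, hγ'.2 y⟩

/-- All the arcs of the curves in `Γ`. -/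
def systemArcs (F : κ → ℝ[X][Y]) (X : Finset ℝ) (Γ : Finset κ) : Finset (ArcLabel κ) :=
  Γ.biUnion fun γ => curveArcs X γ (F γ)

lemma mem_systemArcs {X : Finset ℝ} {a : ArcLabel κ} :
    a ∈ systemArcs F X Γ ↔ ∃ γ ∈ Γ, a ∈ curveArcs X γ (F γ) := Finset.mem_biUnion

lemma incidenceCount_zeros_le (hF : ∀ γ ∈ Γ, F γ ≠ 0) (hFe : ∀ γ ∈ Γ, (F γ).natDegree ≤ e)
    (hFx : ∀ γ ∈ Γ, ∀ i, ((F γ).coeff i).natDegree ≤ e)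
    (hfin : ∀ γ ∈ Γ, ∀ γ' ∈ Γ, γ ≠ γ' →
      {p : ℝ × ℝ | (F γ).evalEval p.1 p.2 = 0 ∧ (F γ').evalEval p.1 p.2 = 0}.Finite)
    (V : Finset (ℝ × ℝ)) :
    incidenceCount (fun (p : ℝ × ℝ) γ => (F γ).evalEval p.1 p.2 = 0) V Γ ≤
      #V + #Γ * (e * ((2 * e * e + e) * e)) +
        incidenceCount (branches κ).On V (systemArcs F (V.image Prod.fst) Γ) := by
  set X := V.image Prod.fst with hX
  have hdisj : (Γ : Set κ).PairwiseDisjoint fun γ => curveArcs X γ (F γ) := by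
    intro γ _ γ' _ hne
    refine Finset.disjoint_left.2 fun a ha ha' => hne ?_
    rw [← (mem_curveArcs ha).1, (mem_curveArcs ha').1]
  have hsum : incidenceCount (branches κ).On V (systemArcs F X Γ) =
      ∑ γ ∈ Γ, ∑ a ∈ curveArcs X γ (F γ), #{p ∈ V | (branches κ).On p a} := by
    rw [incidenceCount, systemArcs, Finset.sum_biUnion hdisj]
  have hone : ∀ γ ∈ Γ, #{p ∈ V | (F γ).evalEval p.1 p.2 = 0} ≤
      #{p ∈ V | ∀ y, (F γ).evalEval p.1 y = 0} + e * ((2 * e * e + e) * e) +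
        ∑ a ∈ curveArcs X γ (F γ), #{p ∈ V | (branches κ).On p a} := by
    intro γ hγ
    refine le_trans (Finset.card_le_card (t := {p ∈ V | ∀ y, (F γ).evalEval p.1 y = 0} ∪
      {p ∈ V | ∃ h ∈ yFactors (F γ), h.evalEval p.1 p.2 = 0 ∧ p.1 ∈ critical h ∧
        fiber h p.1 ≠ 0} ∪
      (curveArcs X γ (F γ)).biUnion fun a => {p ∈ V | (branches κ).On p a}) ?_) ?_
    · intro p hp
      obtain ⟨hpV, hp⟩ := Finset.mem_filter.1 hp
      simp only [Finset.mem_union, Finset.mem_filter, Finset.mem_biUnion]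
      rcases vertical_or_exceptional_or_on (hF γ hγ) (hFe γ hγ) (hFx γ hγ) γ
        (Finset.mem_image_of_mem Prod.fst hpV) hp with h | h | ⟨a, ha, h⟩
      · exact Or.inl (Or.inl ⟨hpV, h⟩)
      · exact Or.inl (Or.inr ⟨hpV, h⟩)
      · exact Or.inr ⟨a, ha, hpV, h⟩
    · refine (Finset.card_union_le _ _).trans (add_le_add ?_ Finset.card_biUnion_le)
      exact (Finset.card_union_le _ _).trans (add_le_add le_rfl
        (card_exceptional_le (hF γ hγ) (hFe γ hγ) (hFx γ hγ) V))
  rw [hsum, incidenceCount]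
  refine (Finset.sum_le_sum hone).trans ?_
  rw [Finset.sum_add_distrib, Finset.sum_add_distrib, Finset.sum_const, smul_eq_mul]
  exact Nat.add_le_add_right (Nat.add_le_add_right (sum_card_vertical_le hfin V) _) _

lemma card_systemArcs_through_le (hF : ∀ γ ∈ Γ, F γ ≠ 0)
    (hFe : ∀ γ ∈ Γ, (F γ).natDegree ≤ e) (hFx : ∀ γ ∈ Γ, ∀ i, ((F γ).coeff i).natDegree ≤ e)
    (X : Finset ℝ) (T : Finset (ℝ × ℝ)) :
    #{a ∈ systemArcs F X Γ | ∀ p ∈ T, (branches κ).On p a} ≤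
      #{γ ∈ Γ | ∀ p ∈ T, (F γ).evalEval p.1 p.2 = 0} * (e * ((2 * e * e + e + 1) * e)) := by
  refine (Finset.card_le_card (t := {γ ∈ Γ | ∀ p ∈ T, (F γ).evalEval p.1 p.2 = 0}.biUnion
    fun γ => curveArcs X γ (F γ)) ?_).trans (Finset.card_biUnion_le_card_mul _ _ _ ?_)
  · intro a ha
    obtain ⟨ha, hT⟩ := Finset.mem_filter.1 ha
    obtain ⟨γ, hγ, ha⟩ := mem_systemArcs.1 ha
    refine Finset.mem_biUnion.2 ⟨γ, Finset.mem_filter.2 ⟨hγ, fun p hp => ?_⟩, ha⟩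
    exact evalEval_eq_zero_of_dvd (dvd_of_mem_yFactors (mem_curveArcs ha).2.1)
      (evalEval_eq_zero_of_on (hT p hp))
  · intro γ hγ
    have hγ := (Finset.mem_filter.1 hγ).1
    exact card_curveArcs_le (hF γ hγ) (hFe γ hγ) (hFx γ hγ) X γ

end CurveSystem

section PolynomialConversion

lemma evalEval_equivMvPolynomial_symm (f : MvPolynomial (Fin 2) ℝ) (v : Fin 2 → ℝ) :
    ((Bivariate.equivMvPolynomial ℝ).symm f).evalEval (v 0) (v 1) = MvPolynomial.eval v f := by
  induction f using MvPolynomial.induction_on with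
  | C a => simp [evalEval_C]
  | add p q hp hq => rw [map_add, evalEval_add, hp, hq, map_add]
  | mul_X p i hp =>
    rw [map_mul, evalEval_mul, hp, map_mul, MvPolynomial.eval_X]
    congr 1
    fin_cases i
    · simp [evalEval_C]
    · simp [evalEval_X]

lemma equivMvPolynomial_symm_eq_sum (f : MvPolynomial (Fin 2) ℝ) :
    (Bivariate.equivMvPolynomial ℝ).symm f =
      ∑ m ∈ f.support, C (C (f.coeff m) * X ^ m 0) * X ^ m 1 := by
  conv_lhs => rw [f.as_sum, map_sum]
  refine Finset.sum_congr rfl fun m _ => ?_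
  rw [MvPolynomial.monomial_eq, Finsupp.prod_fintype _ _ (by simp), Fin.prod_univ_two]
  simp only [map_mul, map_pow, Bivariate.equivMvPolynomial_symm_C,
    Bivariate.equivMvPolynomial_symm_X_0, Bivariate.equivMvPolynomial_symm_X_1]
  ring

lemma apply_le_totalDegree {f : MvPolynomial (Fin 2) ℝ} {m : Fin 2 →₀ ℕ} (hm : m ∈ f.support)
    (i : Fin 2) : m i ≤ f.totalDegree := by
  refine le_trans ?_ (MvPolynomial.le_totalDegree hm)
  rw [Finsupp.sum_fintype _ _ fun _ => rfl]
  exact Finset.single_le_sum (f := fun i => m i) (fun _ _ => Nat.zero_le _) (Finset.mem_univ i)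

lemma natDegree_equivMvPolynomial_symm_le (f : MvPolynomial (Fin 2) ℝ) :
    ((Bivariate.equivMvPolynomial ℝ).symm f).natDegree ≤ f.totalDegree := by
  rw [equivMvPolynomial_symm_eq_sum]
  refine natDegree_sum_le_of_forall_le _ _ fun m hm => ?_
  exact (natDegree_C_mul_X_pow_le _ _).trans (apply_le_totalDegree hm 1)

lemma natDegree_coeff_equivMvPolynomial_symm_le (f : MvPolynomial (Fin 2) ℝ) (i : ℕ) :
    (((Bivariate.equivMvPolynomial ℝ).symm f).coeff i).natDegree ≤ f.totalDegree := by
  rw [equivMvPolynomial_symm_eq_sum, finsetSum_coeff]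
  refine natDegree_sum_le_of_forall_le _ _ fun m hm => ?_
  rw [coeff_C_mul_X_pow]
  split_ifs
  · exact (natDegree_C_mul_X_pow_le _ _).trans (apply_le_totalDegree hm 0)
  · simp

end PolynomialConversion

section MainBound

variable {κ : Type*} {F : κ → ℝ[X][Y]} {e : ℕ} {Γ : Finset κ}

/-- The number of arcs into which a curve of degree at most `e` is cut. -/
def arcBound (e : ℕ) : ℕ := e * ((2 * e * e + e + 1) * e)

/-- The constant in the incidence bound for arcs obtained from curves of degree at most `e`. -/
def arcConstant (e k s : ℕ) : ℝ :=
  k + 2 + 3 * (s * arcBound e : ℕ) + 9 * (2 * e * e + 1 : ℕ) +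
    2 * ((2 * e * e + 1 : ℕ) + 2 * k * (25 + 54 * (2 * e * e + 1) : ℕ)) + 4 * 5

lemma arcConstant_pos (e k s : ℕ) : 0 < arcConstant e k s := by
  rw [arcConstant]
  positivity

/-- The constant in the incidence bound for curves of degree at most `e`. -/
def curveConstant (e k s : ℕ) : ℝ :=
  1 + (e * ((2 * e * e + e) * e) : ℕ) + arcConstant e k s + arcConstant e k s * arcBound e

lemma curveConstant_pos (e k s : ℕ) : 0 < curveConstant e k s := by
  have := arcConstant_pos e k s
  rw [curveConstant]
  positivity

/-- The incidence bound for the zero sets of bivariate polynomials. -/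
theorem incidenceCount_zeros_le_rpow (he : 1 ≤ e) (hF : ∀ γ ∈ Γ, F γ ≠ 0)
    (hFe : ∀ γ ∈ Γ, (F γ).natDegree ≤ e) (hFx : ∀ γ ∈ Γ, ∀ i, ((F γ).coeff i).natDegree ≤ e)
    (hfin : ∀ γ ∈ Γ, ∀ γ' ∈ Γ, γ ≠ γ' →
      {p : ℝ × ℝ | (F γ).evalEval p.1 p.2 = 0 ∧ (F γ').evalEval p.1 p.2 = 0}.Finite)
    {k s : ℕ} (hk : 2 ≤ k) (V : Finset (ℝ × ℝ))
    (hs : ∀ T : Finset (ℝ × ℝ), #T = k →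
      #{γ ∈ Γ | ∀ p ∈ T, (F γ).evalEval p.1 p.2 = 0} ≤ s) :
    (incidenceCount (fun (p : ℝ × ℝ) γ => (F γ).evalEval p.1 p.2 = 0) V Γ : ℝ) ≤
      curveConstant e k s *
        ((#V : ℝ) ^ ((k : ℝ) / (2 * k - 1)) * (#Γ : ℝ) ^ ((2 * (k : ℝ) - 2) / (2 * k - 1))
          + #V + #Γ) := by
  have h1 := incidenceCount_zeros_le hF hFe hFx hfin V
  set Λ := systemArcs F (V.image Prod.fst) Γ with hΛ
  have h2 : (incidenceCount (branches κ).On V Λ : ℝ) ≤ arcConstant e k s *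
      ((#V : ℝ) ^ ((k : ℝ) / (2 * k - 1)) * (#Λ : ℝ) ^ ((2 * (k : ℝ) - 2) / (2 * k - 1))
        + #V + #Λ) := by
    refine (branches κ).incidenceCount_le V Λ hk (fun a ha b hb hab => ?_) fun T _ hT => ?_
    · obtain ⟨γ, hγ, ha⟩ := mem_systemArcs.1 ha
      obtain ⟨γ', hγ', hb⟩ := mem_systemArcs.1 hb
      exact meet_branches hF hFe hFx hfin hγ hγ' ha hb hab
    · exact (card_systemArcs_through_le hF hFe hFx _ T).trans (Nat.mul_le_mul_right _ (hs T hT))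
  have hΛcard : (#Λ : ℝ) ≤ arcBound e * #Γ := by
    have : #Λ ≤ #Γ * arcBound e := Finset.card_biUnion_le_card_mul _ _ _ fun γ hγ =>
      card_curveArcs_le (hF γ hγ) (hFe γ hγ) (hFx γ hγ) _ γ
    rw [mul_comm]
    exact_mod_cast this
  have hL : (1 : ℝ) ≤ arcBound e := by
    have : 0 < arcBound e := by
      rw [arcBound]
      positivity
    exact_mod_cast this
  have hk' : (2 : ℝ) ≤ k := by exact_mod_cast hk
  set θ := (2 * (k : ℝ) - 2) / (2 * k - 1) with hθ
  set m := (#V : ℝ) ^ ((k : ℝ) / (2 * k - 1)) with hm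
  have hm0 : 0 ≤ m := by positivity
  have hθ0 : 0 ≤ θ := div_nonneg (by linarith) (by linarith)
  have hθ1 : θ ≤ 1 := (div_le_one (by linarith)).2 (by linarith)
  have hpow : (#Λ : ℝ) ^ θ ≤ arcBound e * (#Γ : ℝ) ^ θ := by
    refine (Real.rpow_le_rpow (by positivity) hΛcard hθ0).trans ?_
    rw [Real.mul_rpow (by positivity) (by positivity)]
    exact mul_le_mul_of_nonneg_right (Real.rpow_le_self_of_one_le hL hθ1) (by positivity)
  have hK := (arcConstant_pos e k s).le
  set K := arcConstant e k s with hK'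
  set L : ℝ := (arcBound e : ℝ) with hL'
  have h3 : K * (m * (#Λ : ℝ) ^ θ + #V + #Λ) ≤ K * (m * (L * (#Γ : ℝ) ^ θ) + #V + L * #Γ) := by
    gcongr
  have h1' : (incidenceCount (fun (p : ℝ × ℝ) γ => (F γ).evalEval p.1 p.2 = 0) V Γ : ℝ) ≤
      #V + #Γ * (e * ((2 * e * e + e) * e) : ℕ) + incidenceCount (branches κ).On V Λ := by
    exact_mod_cast h1
  rw [curveConstant]
  set E : ℝ := ((e * ((2 * e * e + e) * e) : ℕ) : ℝ) with hE
  have hE0 : 0 ≤ E := by positivity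
  have t1 : 0 ≤ (1 + E + K) * (m * (#Γ : ℝ) ^ θ) := by positivity
  have t2 : 0 ≤ (E + K * L) * (#V : ℝ) := by positivity
  have t3 : 0 ≤ (1 + K) * (#Γ : ℝ) := by positivity
  linarith

end MainBound

section Plane

/-- The coordinates of a point of the Euclidean plane. -/
def planeEquiv : EuclideanSpace ℝ (Fin 2) ≃ ℝ × ℝ where
  toFun p := (p 0, p 1)
  invFun q := !₂[q.1, q.2]
  left_inv p := by
    ext i
    fin_cases i <;> rfl
  right_inv _ := rfl

lemma ncard_incidences_eq {P : Type*} (V : Finset P) (Γ : Finset (Set P)) :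
    {pγ : P × Set P | pγ.1 ∈ V ∧ pγ.2 ∈ Γ ∧ pγ.1 ∈ pγ.2}.ncard =
      incidenceCount (fun p γ => p ∈ γ) V Γ := by
  have : {pγ : P × Set P | pγ.1 ∈ V ∧ pγ.2 ∈ Γ ∧ pγ.1 ∈ pγ.2} =
      ({pγ ∈ V ×ˢ Γ | pγ.1 ∈ pγ.2} : Finset (P × Set P)) := by
    ext pγ
    simp [and_assoc]
  rw [this, Set.ncard_coe_finset, incidenceCount, Finset.card_filter, Finset.sum_product_right]
  exact Finset.sum_congr rfl fun γ _ => (Finset.card_filter _ _).symm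

end Plane

end

/-- (Pach–Sharir) Incidence bound for points and algebraic curves with `k` degrees
of freedom. -/
theorem pach_sharir_incidence_bound (d k s : ℕ) (hd : 1 ≤ d) (hk : 2 ≤ k) (hs : 1 ≤ s) :
    ∃ C : ℝ, 0 < C ∧
      ∀ (V : Finset (EuclideanSpace ℝ (Fin 2)))
        (Γ : Finset (Set (EuclideanSpace ℝ (Fin 2)))),
        -- every element of Γ is a plane algebraic curve of degree at most d
        (∀ γ ∈ Γ, ∃ f : MvPolynomial (Fin 2) ℝ, f ≠ 0 ∧ f.totalDegree ≤ d ∧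
            γ = {x : EuclideanSpace ℝ (Fin 2) | MvPolynomial.eval (fun i => x i) f = 0}) →
        -- any two distinct curves of Γ have finite intersection
        (∀ γ₁ ∈ Γ, ∀ γ₂ ∈ Γ, γ₁ ≠ γ₂ → (γ₁ ∩ γ₂).Finite) →
        -- any k distinct points lie on at most s curves of Γ
        (∀ S : Finset (EuclideanSpace ℝ (Fin 2)), S.card = k →
            ({γ : Set (EuclideanSpace ℝ (Fin 2)) | γ ∈ Γ ∧
              (S : Set (EuclideanSpace ℝ (Fin 2))) ⊆ γ}).ncard ≤ s) →
        ({pγ : EuclideanSpace ℝ (Fin 2) × Set (EuclideanSpace ℝ (Fin 2)) |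
            pγ.1 ∈ V ∧ pγ.2 ∈ Γ ∧ pγ.1 ∈ pγ.2}.ncard : ℝ) ≤
          C * ((V.card : ℝ) ^ ((k : ℝ) / (2 * (k : ℝ) - 1)) *
                (Γ.card : ℝ) ^ ((2 * (k : ℝ) - 2) / (2 * (k : ℝ) - 1)) +
              (V.card : ℝ) + (Γ.card : ℝ)) := by
  classical
  refine ⟨curveConstant d k s, curveConstant_pos d k s, fun V Γ hΓ hfin hS => ?_⟩
  choose! f hf0 hfd hfγ using hΓ
  let F : Set (EuclideanSpace ℝ (Fin 2)) → Polynomial (Polynomial ℝ) := fun γ =>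
    (Polynomial.Bivariate.equivMvPolynomial ℝ).symm (f γ)
  have hmem : ∀ γ ∈ Γ, ∀ p : EuclideanSpace ℝ (Fin 2),
      (F γ).evalEval (planeEquiv p).1 (planeEquiv p).2 = 0 ↔ p ∈ γ := by
    intro γ hγ p
    conv_rhs => rw [hfγ γ hγ]
    exact (evalEval_equivMvPolynomial_symm (f γ) fun i => p i) ▸ Iff.rfl
  have hfin' : ∀ γ ∈ Γ, ∀ γ' ∈ Γ, γ ≠ γ' →
      {p : ℝ × ℝ | (F γ).evalEval p.1 p.2 = 0 ∧ (F γ').evalEval p.1 p.2 = 0}.Finite := by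
    intro γ hγ γ' hγ' hne
    refine ((hfin γ hγ γ' hγ' hne).image planeEquiv).subset fun p hp => ?_
    obtain ⟨q, rfl⟩ := planeEquiv.surjective p
    exact ⟨q, ⟨(hmem γ hγ q).1 hp.1, (hmem γ' hγ' q).1 hp.2⟩, rfl⟩
  have hS' : ∀ T : Finset (ℝ × ℝ), T.card = k →
      (Γ.filter fun γ => ∀ p ∈ T, (F γ).evalEval p.1 p.2 = 0).card ≤ s := by
    intro T hT
    have := hS (T.map planeEquiv.symm.toEmbedding) (by rw [Finset.card_map, hT])
    rw [← Set.ncard_coe_finset]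
    refine le_of_eq_of_le (congrArg Set.ncard ?_) this
    ext γ
    rw [Finset.mem_coe, Finset.mem_filter]
    refine and_congr_right fun hγ => ⟨fun h p hp => ?_, fun h p hp => ?_⟩
    · obtain ⟨q, hq, rfl⟩ := Finset.mem_map.1 hp
      rw [← hmem γ hγ]
      simpa using h q hq
    · have := (hmem γ hγ _).2 (h (Finset.mem_coe.2 (Finset.mem_map_of_mem _ hp)))
      simpa using this
  have hcount := incidenceCount_zeros_le_rpow (F := F) hd
    (fun γ hγ => (map_ne_zero_iff _ (AlgEquiv.injective _)).2 (hf0 γ hγ))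
    (fun γ hγ => (natDegree_equivMvPolynomial_symm_le _).trans (hfd γ hγ))
    (fun γ hγ i => (natDegree_coeff_equivMvPolynomial_symm_le _ i).trans (hfd γ hγ))
    hfin' hk (V.map planeEquiv.toEmbedding) (fun T hT => by convert hS' T hT)
  rw [Finset.card_map] at hcount
  rw [ncard_incidences_eq]
  refine le_of_eq_of_le ?_ hcount
  rw [incidenceCount, incidenceCount]
  congr 1
  refine Finset.sum_congr rfl fun γ hγ => ?_
  rw [Finset.filter_map, Finset.card_map]
  exact congrArg Finset.card (Finset.filter_congr fun p _ => (hmem γ hγ p).symm)
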